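/- arXiv:1610.04578 — 9 statements merged into one kernel-verified Lean document; each statement's English description precedes it below -/
import Mathlib

section
/- Any finite interval I = [I₁..I₂] of positive integers can be partitioned into two finite sequences of disjoint and consecutive intervals, (J^(−a), J^(−a+1), …, J^(0)) and (J^(1), J^(2), …, J^(b)), such that every J^(i) belongs to the geometric covering collection 𝒥 and J^(i) ⊆ I, and the lengths satisfy |J^(−i)|/|J^(−i+1)| ≤ 1/2 for i = 1, …, a and |J^(i+1)|/|J^(i)| ≤ 1/2 for i = 1, …, b−1 (i.e., the lengths successively at least double and then successively at least halve). -/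
/-- `isGC A B` means the interval `[A..B]` belongs to the geometric covering
collection `𝒥 = ⋃_k {[i·2^k .. (i+1)·2^k − 1] : i ≥ 1}`. -/
def isGC (A B : ℕ) : Prop := ∃ k i : ℕ, 1 ≤ i ∧ A = i * 2 ^ k ∧ B = (i + 1) * 2 ^ k - 1

theorem isGC_of_two_pow_dvd {k s : ℕ} (hs : 1 ≤ s) (h : 2 ^ k ∣ s) :
    isGC s (s + 2 ^ k - 1) := by
  obtain ⟨i, rfl⟩ := h
  refine ⟨k, i, Nat.pos_of_ne_zero ?_, mul_comm _ _, ?_⟩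
  · rintro rfl
    simp at hs
  · rw [add_mul, one_mul, mul_comm]

/-- An interval starting at a multiple `c` of `2 ^ k` and shorter than `2 ^ k` splits into geometric
covering intervals whose lengths at least halve from left to right. The endpoints are
`p 0 < p 1 < ⋯ < p b`. -/
theorem exists_halving_endpoints (k c e : ℕ) (hc : 1 ≤ c) (hk : 2 ^ k ∣ c) (hce : c ≤ e)
    (he : e < c + 2 ^ k) :
    ∃ (b : ℕ) (p : ℕ → ℕ), p 0 = c ∧ p b = e ∧ (∀ i ≤ b, c ≤ p i ∧ p i ≤ e) ∧
      (∀ i < b, p i < p (i + 1) ∧ isGC (p i) (p (i + 1) - 1) ∧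
        2 * (p (i + 1) - p i) ≤ 2 ^ k) ∧
      ∀ i, i + 1 < b → 2 * (p (i + 2) - p (i + 1)) ≤ p (i + 1) - p i := by
  induction k generalizing c with
  | zero => exact ⟨0, fun _ => c, by simp at he ⊢; omega⟩
  | succ k ih =>
    have hk' : 2 ^ k ∣ c := (pow_dvd_pow 2 k.le_succ).trans hk
    have h2 : 2 ^ (k + 1) = 2 * 2 ^ k := by ring
    have hpos : 0 < 2 ^ k := by positivity
    by_cases hlt : e < c + 2 ^ k
    · obtain ⟨b, p, h0, hb, hr, hs, hh⟩ := ih c hc hk' hce hlt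
      exact ⟨b, p, h0, hb, hr, fun i hi => ⟨(hs i hi).1, (hs i hi).2.1, by grind⟩, hh⟩
    · obtain ⟨b, p, h0, hb, hr, hs, hh⟩ :=
        ih (c + 2 ^ k) (by omega) (by simpa using hk') (by omega) (by omega)
      refine ⟨b + 1, fun i => if i = 0 then c else p (i - 1), by simp, by simpa using hb,
        ?_, ?_, ?_⟩
      · rintro (_ | i) hi
        · simp [hce]
        · have := hr i (by omega)
          simp only [Nat.add_eq_zero_iff, one_ne_zero, and_false, if_false, Nat.add_sub_cancel]
          omega
      · rintro (_ | i) hi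
        · have := isGC_of_two_pow_dvd hc hk'
          simp only [if_true, h0, zero_add, one_ne_zero, if_false, Nat.sub_self]
          exact ⟨by omega, this, by omega⟩
        · have := hs i (by omega)
          simp only [Nat.add_eq_zero_iff, one_ne_zero, and_false, if_false, Nat.add_sub_cancel]
          exact ⟨this.1, this.2.1, by omega⟩
      · rintro (_ | i) hi
        · have := (hs 0 (by omega)).2.2
          simp [h0] at this ⊢
          omega
        · simpa using hh i (by omega)

/-- An interval ending just before a multiple `c` of `2 ^ k` and shorter than `2 ^ k` splits into
geometric covering intervals whose lengths at least double from left to right. The endpoints are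
`q a < ⋯ < q 1 < q 0`. -/
theorem exists_doubling_endpoints (k c m : ℕ) (hm : 1 ≤ m) (hk : 2 ^ k ∣ c) (hmc : m ≤ c)
    (hc : c < m + 2 ^ k) :
    ∃ (a : ℕ) (q : ℕ → ℕ), q 0 = c ∧ q a = m ∧ (∀ i ≤ a, m ≤ q i ∧ q i ≤ c) ∧
      (∀ i < a, q (i + 1) < q i ∧ isGC (q (i + 1)) (q i - 1) ∧
        2 * (q i - q (i + 1)) ≤ 2 ^ k) ∧
      ∀ i, i + 1 < a → 2 * (q (i + 1) - q (i + 2)) ≤ q i - q (i + 1) := by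
  induction k generalizing c with
  | zero => exact ⟨0, fun _ => c, by simp at hc ⊢; omega⟩
  | succ k ih =>
    have hk' : 2 ^ k ∣ c := (pow_dvd_pow 2 k.le_succ).trans hk
    have h2 : 2 ^ (k + 1) = 2 * 2 ^ k := by ring
    have hpos : 0 < 2 ^ k := by positivity
    by_cases hlt : c < m + 2 ^ k
    · obtain ⟨a, q, h0, ha, hr, hs, hh⟩ := ih c hk' hmc hlt
      exact ⟨a, q, h0, ha, hr, fun i hi => ⟨(hs i hi).1, (hs i hi).2.1, by grind⟩, hh⟩
    · have hd : 2 ^ k ∣ c - 2 ^ k := Nat.dvd_sub hk' dvd_rfl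
      obtain ⟨a, q, h0, ha, hr, hs, hh⟩ := ih (c - 2 ^ k) hd (by omega) (by omega)
      refine ⟨a + 1, fun i => if i = 0 then c else q (i - 1), by simp, by simpa using ha,
        ?_, ?_, ?_⟩
      · rintro (_ | i) hi
        · simp [hmc]
        · have := hr i (by omega)
          simp only [Nat.add_eq_zero_iff, one_ne_zero, and_false, if_false, Nat.add_sub_cancel]
          omega
      · rintro (_ | i) hi
        · have := isGC_of_two_pow_dvd (by omega) hd
          rw [Nat.sub_add_cancel (by omega)] at this
          simp only [if_true, h0, zero_add, one_ne_zero, if_false, Nat.sub_self]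
          exact ⟨by omega, this, by omega⟩
        · have := hs i (by omega)
          simp only [Nat.add_eq_zero_iff, one_ne_zero, and_false, if_false, Nat.add_sub_cancel]
          exact ⟨this.1, this.2.1, by omega⟩
      · rintro (_ | i) hi
        · have := (hs 0 (by omega)).2.2
          simp [h0] at this ⊢
          omega
        · simpa using hh i (by omega)

/-- The element of `[m..e]` divisible by the largest power `2 ^ k` is at distance less than `2 ^ k`
from both ends. -/
theorem exists_two_pow_dvd_near (m e : ℕ) (hm : 1 ≤ m) (hme : m ≤ e) :
    ∃ k c : ℕ, 2 ^ k ∣ c ∧ m ≤ c ∧ c ≤ e ∧ c < m + 2 ^ k ∧ e < c + 2 ^ k := by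
  obtain ⟨k, ⟨c, hd, hmc, hce⟩, hmax⟩ : ∃ k, (∃ c, 2 ^ k ∣ c ∧ m ≤ c ∧ c ≤ e) ∧
      ¬∃ c, 2 ^ (k + 1) ∣ c ∧ m ≤ c ∧ c ≤ e := by
    by_contra! h
    have hall : ∀ k, ∃ c, 2 ^ k ∣ c ∧ m ≤ c ∧ c ≤ e := by
      intro k
      induction k with
      | zero => exact ⟨m, by simp, le_rfl, hme⟩
      | succ k ih => exact h k ih
    obtain ⟨c, hd, hmc, hce⟩ := hall e
    have := Nat.le_of_dvd (by omega) hd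
    have := Nat.lt_two_pow_self (n := e)
    omega
  obtain ⟨t, rfl⟩ := hd
  have hpos : 0 < 2 ^ k := by positivity
  have ht : t % 2 = 1 := by
    by_contra ht
    refine hmax ⟨2 ^ k * t, ?_, hmc, hce⟩
    rw [pow_succ]
    exact mul_dvd_mul_left _ (by omega)
  refine ⟨k, 2 ^ k * t, dvd_mul_right _ _, hmc, hce, ?_, ?_⟩
  · by_contra! hlt
    refine hmax ⟨2 ^ k * (t - 1), ?_, ?_, ?_⟩
    · rw [pow_succ]
      exact mul_dvd_mul_left _ (by omega)
    · rw [Nat.mul_sub, mul_one]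
      omega
    · rw [Nat.mul_sub, mul_one]
      omega
  · by_contra! hlt
    refine hmax ⟨2 ^ k * (t + 1), ?_, ?_, ?_⟩
    · rw [pow_succ]
      exact mul_dvd_mul_left _ (by omega)
    · rw [mul_add, mul_one]
      omega
    · rwa [mul_add, mul_one]

/-- Any interval `[I₁..I₂]` of positive integers can be partitioned into two consecutive
sequences of geometric covering intervals `J^(-a), …, J^(0)` and `J^(1), …, J^(b)`
whose lengths successively at least double and then successively at least halve. -/
theorem geometric_covering_partition (I₁ I₂ : ℕ) (h1 : 1 ≤ I₁) (h12 : I₁ ≤ I₂) :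
    ∃ (a b : ℕ) (st en : ℤ → ℕ),
      st (-(a : ℤ)) = I₁ ∧ en (b : ℤ) = I₂ ∧
      (∀ i : ℤ, -(a : ℤ) ≤ i → i < (b : ℤ) → st (i + 1) = en i + 1) ∧
      (∀ i : ℤ, -(a : ℤ) ≤ i → i ≤ (b : ℤ) →
        isGC (st i) (en i) ∧ I₁ ≤ st i ∧ st i ≤ en i ∧ en i ≤ I₂) ∧
      (∀ i : ℤ, 1 ≤ i → i ≤ (a : ℤ) →
        2 * (en (-i) - st (-i) + 1) ≤ en (-i + 1) - st (-i + 1) + 1) ∧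
      (∀ i : ℤ, 1 ≤ i → i ≤ (b : ℤ) - 1 →
        2 * (en (i + 1) - st (i + 1) + 1) ≤ en i - st i + 1) := by
  obtain ⟨k, c, hk, hmc, hce, hcm, hec⟩ := exists_two_pow_dvd_near I₁ (I₂ + 1) h1 (by omega)
  obtain ⟨b, p, hp0, hpb, hpr, hps, hph⟩ :=
    exists_halving_endpoints k c (I₂ + 1) (by omega) hk hce hec
  obtain ⟨a, q, hq0, hqa, hqr, hqs, hqh⟩ := exists_doubling_endpoints k c I₁ h1 hk hmc hcm
  rcases a with _ | a
  · rcases b with _ | b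
    · omega
    refine ⟨0, b, fun i => p i.toNat, fun i => p (i.toNat + 1) - 1, by simp; omega,
      by simp [hpb], fun i h h' => ?_, fun i h h' => ?_, fun i h h' => by simp at h'; omega,
      fun i h h' => ?_⟩ <;> lift i to ℕ using by simpa using (by omega)
    · have := (hps i (by omega)).1
      simp only [Int.toNat_natCast, Int.toNat_natCast_add_one]
      omega
    · have hs := hps i (by omega)
      have := hpr i (by omega)
      have := hpr (i + 1) (by omega)
      simp only [Int.toNat_natCast]
      exact ⟨hs.2.1, by omega, by omega, by omega⟩
    · have := hph i (by omega)
      have := (hps i (by omega)).1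
      have := (hps (i + 1) (by omega)).1
      simp only [Int.toNat_natCast, Int.toNat_natCast_add_one]
      simp only [add_assoc, Nat.reduceAdd] at *
      omega
  · let P : ℤ → ℕ := fun i => if 0 ≤ i then p i.toNat else q (-i).toNat
    have hP (n : ℕ) : P n = p n := by simp [P]
    have hQ (n : ℕ) : P (-n) = q n := by
      rcases n with _ | n
      · simp [P, hp0, hq0]
      · have : ¬ (0 : ℤ) ≤ -((n + 1 : ℕ) : ℤ) := by omega
        simp only [P, if_neg this, neg_neg, Int.toNat_natCast]
    have hstep (i : ℤ) (hi : -(a : ℤ) ≤ i) (hib : i ≤ b) :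
        P (i - 1) < P i ∧ isGC (P (i - 1)) (P i - 1) ∧ I₁ ≤ P (i - 1) ∧ P i ≤ I₂ + 1 := by
      obtain ⟨n, rfl | rfl⟩ : ∃ n : ℕ, i = -n ∨ i = n + 1 := by
        rcases le_or_gt i 0 with h | h
        · exact ⟨(-i).toNat, by omega⟩
        · exact ⟨(i - 1).toNat, by omega⟩
      · have e : -(n : ℤ) - 1 = -((n + 1 : ℕ) : ℤ) := by push_cast; ring
        rw [e, hQ, hQ]
        have hs := hqs n (by omega)
        have := hqr n (by omega)
        have := hqr (n + 1) (by omega)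
        exact ⟨hs.1, hs.2.1, by omega, by omega⟩
      · have e : (n : ℤ) + 1 = ((n + 1 : ℕ) : ℤ) := by push_cast; ring
        rw [add_sub_cancel_right, e, hP, hP]
        have hs := hps n (by omega)
        have := hpr n (by omega)
        have := hpr (n + 1) (by omega)
        exact ⟨hs.1, hs.2.1, by omega, by omega⟩
    refine ⟨a, b, fun i => P (i - 1), fun i => P i - 1, ?_, ?_, fun i h h' => ?_,
      fun i h h' => ?_, fun i h h' => ?_, fun i h h' => ?_⟩
    · have e : -(a : ℤ) - 1 = -((a + 1 : ℕ) : ℤ) := by push_cast; ring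
      simp only [e, hQ, hqa]
    · simp [hP, hpb]
    · have := (hstep i h (by omega)).1
      simp only [add_sub_cancel_right]
      omega
    · have hs := hstep i h h'
      exact ⟨hs.2.1, hs.2.2.1, by grind, by grind⟩
    · obtain ⟨n, rfl⟩ : ∃ n : ℕ, i = n + 1 := ⟨(i - 1).toNat, by omega⟩
      have e₁ : -((n : ℤ) + 1) - 1 = -((n + 2 : ℕ) : ℤ) := by push_cast; ring
      have e₂ : -((n : ℤ) + 1) = -((n + 1 : ℕ) : ℤ) := by push_cast; ring
      have e₃ : -((n : ℤ) + 1) + 1 = -(n : ℤ) := by ring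
      have e₄ : -(n : ℤ) - 1 = -((n + 1 : ℕ) : ℤ) := by push_cast; ring
      have := hqh n (by omega)
      have := (hqs n (by omega)).1
      have := (hqs (n + 1) (by omega)).1
      simp only [e₁, e₃, e₄]
      simp only [e₂, hQ]
      simp only [add_assoc, Nat.reduceAdd] at *
      omega
    · obtain ⟨n, rfl⟩ : ∃ n : ℕ, i = n + 1 := ⟨(i - 1).toNat, by omega⟩
      have e₁ : (n : ℤ) + 1 + 1 = ((n + 2 : ℕ) : ℤ) := by push_cast; ring
      have e₂ : (n : ℤ) + 1 = ((n + 1 : ℕ) : ℤ) := by push_cast; ring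
      have e₃ : ((n + 2 : ℕ) : ℤ) - 1 = ((n + 1 : ℕ) : ℤ) := by push_cast; ring
      have := hph n (by omega)
      have := (hps n (by omega)).1
      have := (hps (n + 1) (by omega)).1
      simp only [add_sub_cancel_right, e₁, e₃]
      simp only [e₂, hP]
      simp only [add_assoc, Nat.reduceAdd] at *
      omega
end

section
/- (Regret of Sleeping CB) Let (F_t)_{t≥1} be a sequence of even, strictly positive potential functions satisfying the wealth lower bound. Suppose there are constants c₁ > 0 and c_{2,i} ∈ ℝ (i = 1, …, N) such that ln F_{S_{T,i}}(x) ≥ c₁·x²/S_{T,i} + c_{2,i} for all x ∈ ℝ and all i. Then for every u ∈ Δ^N, the Sleeping CB algorithm satisfies Regret_T(u) ≤ sqrt( c₁^{−1} · (∑_{i=1}^N u_i S_{T,i}) · ( KL(u‖π) − ∑_{i=1}^N u_i c_{2,i} ) ). -/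
open Finset

/-- `BettingRun F s z W` says that `s` rounds of coin betting with the potentials `F`, on coin
flips in `[-1, 1]` summing to `z`, turn an initial wealth of `1` into `W`. -/
inductive BettingRun (F : ℕ → ℝ → ℝ) : ℕ → ℝ → ℝ → Prop
  | nil : BettingRun F 0 0 1
  | step {s : ℕ} {z W : ℝ} (γ : ℝ) (hγ : |γ| ≤ 1) (hrun : BettingRun F s z W) :
      BettingRun F (s + 1) (z + γ)
        (W + γ * ((F (s + 1) (z + 1) - F (s + 1) (z - 1)) /
          (F (s + 1) (z + 1) + F (s + 1) (z - 1)) * W))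

/-- `w` is the sequence of bets prescribed by the potentials `F` against the coin flips `g`
during the first `s` rounds. -/
def IsBetSequence (F : ℕ → ℝ → ℝ) (s : ℕ) (g w : ℕ → ℝ) : Prop :=
  ∀ τ ∈ Icc 1 s, w τ =
    (F τ ((∑ σ ∈ Icc 1 (τ - 1), g σ) + 1) - F τ ((∑ σ ∈ Icc 1 (τ - 1), g σ) - 1)) /
      (F τ ((∑ σ ∈ Icc 1 (τ - 1), g σ) + 1) + F τ ((∑ σ ∈ Icc 1 (τ - 1), g σ) - 1)) *
      (1 + ∑ σ ∈ Icc 1 (τ - 1), g σ * w σ)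

lemma sum_Icc_update_succ (f : ℕ → ℝ) (s m : ℕ) (hm : m ≤ s) (a : ℝ) :
    ∑ σ ∈ Icc 1 m, Function.update f (s + 1) a σ = ∑ σ ∈ Icc 1 m, f σ :=
  sum_congr rfl fun σ hσ => Function.update_of_ne (by have := (mem_Icc.1 hσ).2; omega) _ _

lemma sum_Icc_update_mul_update_succ (f g : ℕ → ℝ) (s m : ℕ) (hm : m ≤ s) (a b : ℝ) :
    ∑ σ ∈ Icc 1 m, Function.update f (s + 1) a σ * Function.update g (s + 1) b σ =
      ∑ σ ∈ Icc 1 m, f σ * g σ :=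
  sum_congr rfl fun σ hσ => by
    have hne : σ ≠ s + 1 := by have := (mem_Icc.1 hσ).2; omega
    rw [Function.update_of_ne hne, Function.update_of_ne hne]

lemma BettingRun.exists_sequences {F : ℕ → ℝ → ℝ} {s : ℕ} {z W : ℝ}
    (hrun : BettingRun F s z W) :
    ∃ g w : ℕ → ℝ, (∀ τ ∈ Icc 1 s, |g τ| ≤ 1) ∧ IsBetSequence F s g w ∧
      z = ∑ τ ∈ Icc 1 s, g τ ∧ W = 1 + ∑ τ ∈ Icc 1 s, g τ * w τ := by
  induction hrun with
  | nil => exact ⟨0, 0, by simp, fun τ hτ => by simp at hτ, by simp, by simp⟩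
  | @step s z W γ hγ _ ih =>
    obtain ⟨g, w, hg, hw, hz, hW⟩ := ih
    refine ⟨Function.update g (s + 1) γ, Function.update w (s + 1)
      ((F (s + 1) (z + 1) - F (s + 1) (z - 1)) / (F (s + 1) (z + 1) + F (s + 1) (z - 1)) * W),
      fun τ hτ => ?_, fun τ hτ => ?_, ?_, ?_⟩
    · rcases eq_or_ne τ (s + 1) with rfl | hne
      · simpa using hγ
      · rw [Function.update_of_ne hne]
        exact hg τ (by rw [mem_Icc] at hτ ⊢; omega)
    · have hle : τ - 1 ≤ s := by have := (mem_Icc.1 hτ).2; omega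
      rw [sum_Icc_update_succ _ _ _ hle, sum_Icc_update_mul_update_succ _ _ _ _ hle]
      rcases eq_or_ne τ (s + 1) with rfl | hne
      · rw [Function.update_self, Nat.add_sub_cancel, ← hz, ← hW]
      · rw [Function.update_of_ne hne]
        exact hw τ (by rw [mem_Icc] at hτ ⊢; omega)
    · rw [sum_Icc_succ_top (by omega), sum_Icc_update_succ _ _ _ le_rfl, Function.update_self, hz]
    · rw [sum_Icc_succ_top (by omega), sum_Icc_update_mul_update_succ _ _ _ _ le_rfl,
        Function.update_self, Function.update_self, ← add_assoc, ← hW]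

/-- Betting only in the awake rounds is a run whose length is the number of awake rounds. -/
lemma bettingRun_of_awake (F : ℕ → ℝ → ℝ) (T : ℕ) (a : ℕ → ℕ) (ha : ∀ t, a t ≤ 1)
    (g w : ℕ → ℝ) (hg : ∀ t ∈ Icc 1 T, |g t| ≤ 1)
    (hw : ∀ t ∈ Icc 1 T, w t =
      (F (1 + ∑ τ ∈ Icc 1 (t - 1), a τ) ((∑ τ ∈ Icc 1 (t - 1), (a τ : ℝ) * g τ) + 1) -
          F (1 + ∑ τ ∈ Icc 1 (t - 1), a τ) ((∑ τ ∈ Icc 1 (t - 1), (a τ : ℝ) * g τ) - 1)) /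
        (F (1 + ∑ τ ∈ Icc 1 (t - 1), a τ) ((∑ τ ∈ Icc 1 (t - 1), (a τ : ℝ) * g τ) + 1) +
          F (1 + ∑ τ ∈ Icc 1 (t - 1), a τ) ((∑ τ ∈ Icc 1 (t - 1), (a τ : ℝ) * g τ) - 1)) *
        (1 + ∑ τ ∈ Icc 1 (t - 1), (a τ : ℝ) * g τ * w τ)) :
    ∀ t ≤ T, BettingRun F (∑ τ ∈ Icc 1 t, a τ) (∑ τ ∈ Icc 1 t, (a τ : ℝ) * g τ)
      (1 + ∑ τ ∈ Icc 1 t, (a τ : ℝ) * g τ * w τ) := by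
  intro t
  induction t with
  | zero => intro _; simpa using BettingRun.nil
  | succ t ih =>
    intro ht
    have hrun := ih (by omega)
    have hmem : t + 1 ∈ Icc 1 T := mem_Icc.2 ⟨by omega, ht⟩
    simp only [sum_Icc_succ_top (show 1 ≤ t + 1 by omega)]
    rcases Nat.le_one_iff_eq_zero_or_eq_one.1 (ha (t + 1)) with h0 | h1
    · simpa [h0] using hrun
    · have hstep := hrun.step (g (t + 1)) (hg _ hmem)
      have hbet := hw (t + 1) hmem
      rw [Nat.add_sub_cancel, add_comm 1 (∑ τ ∈ Icc 1 t, a τ)] at hbet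
      rw [← hbet] at hstep
      simpa [h1, add_assoc] using hstep

/-- The Gibbs variational inequality for finite sums. -/
lemma sum_mul_log_le_sum_mul_log_div {ι : Type*} [Fintype ι] (π u W : ι → ℝ)
    (hπ : ∀ i, 0 < π i) (hu0 : ∀ i, 0 ≤ u i) (hu1 : ∑ i, u i = 1) (hW : ∀ i, 0 < W i)
    (hπW : ∑ i, π i * W i ≤ 1) :
    ∑ i, u i * Real.log (W i) ≤ ∑ i, u i * Real.log (u i / π i) := by
  have key : ∀ i, u i * Real.log (W i) ≤ u i * Real.log (u i / π i) + (π i * W i - u i) := by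
    intro i
    rcases (hu0 i).eq_or_lt with h0 | hpos
    · rw [← h0]
      have := mul_pos (hπ i) (hW i)
      simp [this.le]
    · have hlog := Real.log_le_sub_one_of_pos (div_pos (hW i) (div_pos hpos (hπ i)))
      rw [Real.log_div (hW i).ne' (div_pos hpos (hπ i)).ne'] at hlog
      have hmul := mul_le_mul_of_nonneg_left hlog hpos.le
      have heq : u i * (W i / (u i / π i) - 1) = π i * W i - u i := by
        field_simp
      rw [heq] at hmul
      linarith
  have hsum := sum_le_sum fun i (_ : i ∈ univ) => key i
  rw [sum_add_distrib, sum_sub_distrib, hu1] at hsum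
  linarith

/-- Cauchy–Schwarz with the weights `u` and the scales `S`. -/
lemma sq_sum_mul_le_sum_mul_sq_div {ι : Type*} [Fintype ι] (u G S : ι → ℝ)
    (hu : ∀ i, 0 ≤ u i) (hS : ∀ i, 0 < S i) :
    (∑ i, u i * G i) ^ 2 ≤ (∑ i, u i * S i) * ∑ i, u i * (G i ^ 2 / S i) := by
  refine sum_sq_le_sum_mul_sum_of_sq_le_mul _ (fun i _ => mul_nonneg (hu i) (hS i).le)
    (fun i _ => mul_nonneg (hu i) (div_nonneg (sq_nonneg _) (hS i).le)) fun i _ => ?_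
  have := (hS i).ne'
  exact le_of_eq (by field_simp)


/-- **Regret of Sleeping CB.** Let `(F_t)` be a sequence of even, strictly positive
potentials satisfying the wealth lower bound, and suppose
`ln F_{S_{T,i}}(x) ≥ c₁·x²/S_{T,i} + c_{2,i}` for all `x` and `i`. Then the Sleeping CB
algorithm (with prior `π`, awake indicators `ℐ`, losses `ℓ`, bets `w`, signed coin flips
`gt`, predictions `p`, suffered losses `h`) satisfies, for every `u ∈ Δ^N`,
`Regret_T(u) ≤ √( c₁⁻¹ · (∑ u_i S_{T,i}) · (KL(u‖π) − ∑ u_i c_{2,i}) )`. -/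
theorem sleeping_cb_regret (N T : ℕ) (hN : 0 < N) (hT : 0 < T)
    (π : Fin N → ℝ) (hπ0 : ∀ i, 0 < π i) (hπ1 : ∑ i, π i = 1)
    (ℐ : ℕ → Fin N → ℕ) (hI01 : ∀ t i, ℐ t i ≤ 1)
    (hIpos : ∀ t ∈ Finset.Icc 1 T, 0 < ∑ i, π i * (ℐ t i : ℝ))
    (ℓ : ℕ → Fin N → ℝ) (hℓ : ∀ t i, ℓ t i ∈ Set.Icc (0 : ℝ) 1)
    (F : ℕ → ℝ → ℝ) (hFpos : ∀ t x, 0 < F t x) (hFeven : ∀ t x, F t (-x) = F t x)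
    -- the wealth lower bound satisfied by the coin betting potentials
    (hWealth : ∀ s : ℕ, 1 ≤ s → ∀ g w : ℕ → ℝ,
      (∀ τ ∈ Finset.Icc 1 s, |g τ| ≤ 1) →
      (∀ τ ∈ Finset.Icc 1 s, w τ =
        (F τ ((∑ σ ∈ Finset.Icc 1 (τ - 1), g σ) + 1) -
            F τ ((∑ σ ∈ Finset.Icc 1 (τ - 1), g σ) - 1)) /
          (F τ ((∑ σ ∈ Finset.Icc 1 (τ - 1), g σ) + 1) +
            F τ ((∑ σ ∈ Finset.Icc 1 (τ - 1), g σ) - 1)) *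
          (1 + ∑ σ ∈ Finset.Icc 1 (τ - 1), g σ * w σ)) →
      F s (∑ τ ∈ Finset.Icc 1 s, g τ) ≤ 1 + ∑ τ ∈ Finset.Icc 1 s, g τ * w τ)
    -- the quantities computed by the Sleeping CB algorithm
    (S : ℕ → Fin N → ℕ)
    (hS : ∀ t i, S t i = 1 + ∑ τ ∈ Finset.Icc 1 (t - 1), ℐ τ i)
    (w gt : ℕ → Fin N → ℝ) (p : ℕ → Fin N → ℝ) (h : ℕ → ℝ)
    (hw : ∀ t ∈ Finset.Icc 1 T, ∀ i, w t i =
      (F (S t i) ((∑ τ ∈ Finset.Icc 1 (t - 1), (ℐ τ i : ℝ) * gt τ i) + 1) -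
          F (S t i) ((∑ τ ∈ Finset.Icc 1 (t - 1), (ℐ τ i : ℝ) * gt τ i) - 1)) /
        (F (S t i) ((∑ τ ∈ Finset.Icc 1 (t - 1), (ℐ τ i : ℝ) * gt τ i) + 1) +
          F (S t i) ((∑ τ ∈ Finset.Icc 1 (t - 1), (ℐ τ i : ℝ) * gt τ i) - 1)) *
        (1 + ∑ τ ∈ Finset.Icc 1 (t - 1), (ℐ τ i : ℝ) * gt τ i * w τ i))
    (hp : ∀ t ∈ Finset.Icc 1 T, ∀ i, p t i =
      if 0 < ∑ j, π j * (ℐ t j : ℝ) * max (w t j) 0 then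
        π i * (ℐ t i : ℝ) * max (w t i) 0 / ∑ j, π j * (ℐ t j : ℝ) * max (w t j) 0
      else π i * (ℐ t i : ℝ) / ∑ j, π j * (ℐ t j : ℝ))
    (hh : ∀ t ∈ Finset.Icc 1 T, h t = ∑ i, p t i * ℓ t i)
    (hgt : ∀ t ∈ Finset.Icc 1 T, ∀ i, gt t i =
      if ℐ t i = 0 then 0
      else if 0 < w t i then h t - ℓ t i else max (h t - ℓ t i) 0)
    -- the potential lower bound
    (c₁ : ℝ) (hc₁ : 0 < c₁) (c₂ : Fin N → ℝ)
    (hFlb : ∀ i, ∀ x : ℝ, c₁ * x ^ 2 / (S T i : ℝ) + c₂ i ≤ Real.log (F (S T i) x))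
    -- the comparator
    (u : Fin N → ℝ) (hu0 : ∀ i, 0 ≤ u i) (hu1 : ∑ i, u i = 1) :
    ∑ t ∈ Finset.Icc 1 T, ∑ i, (ℐ t i : ℝ) * u i * (h t - ℓ t i) ≤
      Real.sqrt (c₁⁻¹ * (∑ i, u i * (S T i : ℝ)) *
        ((∑ i, u i * Real.log (u i / π i)) - ∑ i, u i * c₂ i)) := by
  have hI0 : ∀ t i, (0 : ℝ) ≤ ℐ t i := fun t i => Nat.cast_nonneg _
  have hpw0 : ∀ t i, 0 ≤ π i * (ℐ t i : ℝ) * max (w t i) 0 := fun t i =>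
    mul_nonneg (mul_nonneg (hπ0 i).le (hI0 t i)) (le_max_right _ _)
  have hp0 : ∀ t ∈ Icc 1 T, ∀ i, 0 ≤ p t i := by
    intro t ht i
    rw [hp t ht i]
    split_ifs with hpos
    · exact div_nonneg (hpw0 t i) hpos.le
    · exact div_nonneg (mul_nonneg (hπ0 i).le (hI0 t i)) (hIpos t ht).le
  have hp1 : ∀ t ∈ Icc 1 T, ∑ i, p t i = 1 := by
    intro t ht
    simp only [hp t ht]
    split_ifs with hpos
    · rw [← sum_div, div_self hpos.ne']
    · rw [← sum_div, div_self (hIpos t ht).ne']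
  have hh0 : ∀ t ∈ Icc 1 T, 0 ≤ h t := fun t ht => by
    rw [hh t ht]
    exact sum_nonneg fun i _ => mul_nonneg (hp0 t ht i) (hℓ t i).1
  have hh1 : ∀ t ∈ Icc 1 T, h t ≤ 1 := fun t ht => by
    rw [hh t ht, ← hp1 t ht]
    exact sum_le_sum fun i _ => mul_le_of_le_one_right (hp0 t ht i) (hℓ t i).2
  have hgabs : ∀ i, ∀ t ∈ Icc 1 T, |gt t i| ≤ 1 := by
    intro i t ht
    have h0 := hh0 t ht
    have h1 := hh1 t ht
    have hl0 := (hℓ t i).1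
    have hl1 := (hℓ t i).2
    rw [hgt t ht i, abs_le]
    split_ifs
    · norm_num
    · constructor <;> linarith
    · exact ⟨by linarith [le_max_right (h t - ℓ t i) 0], max_le (by linarith) (by norm_num)⟩
  have hgge : ∀ i, ∀ t ∈ Icc 1 T, (ℐ t i : ℝ) * (h t - ℓ t i) ≤ ℐ t i * gt t i := by
    intro i t ht
    rw [hgt t ht i]
    split_ifs with hz
    · simp [hz]
    · exact le_rfl
    · exact mul_le_mul_of_nonneg_left (le_max_left _ _) (hI0 t i)
  have hpay : ∀ t ∈ Icc 1 T, ∑ i, π i * ((ℐ t i : ℝ) * gt t i * w t i) ≤ 0 := by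
    intro t ht
    have hle : ∀ i, π i * ((ℐ t i : ℝ) * gt t i * w t i) ≤
        π i * (ℐ t i : ℝ) * max (w t i) 0 * (h t - ℓ t i) := by
      intro i
      rw [hgt t ht i]
      split_ifs with hz hwpos
      · simp [hz]
      · rw [max_eq_left hwpos.le]
        exact le_of_eq (by ring)
      · rw [max_eq_right (not_lt.1 hwpos)]
        have := mul_nonneg (mul_nonneg (hπ0 i).le (hI0 t i)) (le_max_right (h t - ℓ t i) 0)
        have := mul_nonpos_of_nonneg_of_nonpos this (not_lt.1 hwpos)
        linarith
    refine (sum_le_sum fun i _ => hle i).trans ?_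
    by_cases hpos : 0 < ∑ j, π j * (ℐ t j : ℝ) * max (w t j) 0
    · set P := ∑ j, π j * (ℐ t j : ℝ) * max (w t j) 0
      have hpP : ∀ i, π i * (ℐ t i : ℝ) * max (w t i) 0 = P * p t i := by
        intro i
        rw [hp t ht i, if_pos hpos, mul_div_cancel₀ _ hpos.ne']
      have : ∑ i, π i * (ℐ t i : ℝ) * max (w t i) 0 * (h t - ℓ t i) =
          P * (h t * ∑ i, p t i - ∑ i, p t i * ℓ t i) := by
        rw [mul_sum, ← sum_sub_distrib, mul_sum]
        exact sum_congr rfl fun i _ => by rw [hpP i]; ring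
      rw [this, hp1 t ht, ← hh t ht]
      simp
    · have hzero : ∑ j, π j * (ℐ t j : ℝ) * max (w t j) 0 = 0 :=
        le_antisymm (not_lt.1 hpos) (sum_nonneg fun i _ => hpw0 t i)
      rw [sum_eq_zero_iff_of_nonneg fun i _ => hpw0 t i] at hzero
      exact (sum_eq_zero fun i hi => by rw [hzero i hi, zero_mul]).le
  set G : Fin N → ℝ := fun i => ∑ t ∈ Icc 1 T, (ℐ t i : ℝ) * gt t i with hG
  set W : Fin N → ℝ := fun i => 1 + ∑ t ∈ Icc 1 T, (ℐ t i : ℝ) * gt t i * w t i with hW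
  have hπW : ∑ i, π i * W i ≤ 1 := by
    simp only [hW, mul_add, mul_one, sum_add_distrib, hπ1, mul_sum]
    rw [sum_comm]
    linarith [sum_nonpos hpay]
  have hrun : ∀ i, BettingRun F (S T i) (G i) (W i) := by
    intro i
    have hr := bettingRun_of_awake F T (fun t => ℐ t i) (fun t => hI01 t i) (fun t => gt t i)
      (fun t => w t i) (hgabs i) (fun t ht => by simpa only [hS] using hw t ht i) T le_rfl
    have hlen : ∑ t ∈ Icc 1 T, ℐ t i = ∑ t ∈ Icc 1 (T - 1), ℐ t i + ℐ T i := by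
      obtain ⟨n, rfl⟩ : ∃ n, T = n + 1 := ⟨T - 1, by omega⟩
      rw [sum_Icc_succ_top (by omega), Nat.add_sub_cancel]
    rcases Nat.le_one_iff_eq_zero_or_eq_one.1 (hI01 T i) with h0 | h1
    · have hstep := hr.step 0 (by simp)
      have hlast : ∑ t ∈ Icc 1 T, ℐ t i + 1 = S T i := by rw [hS, hlen, h0]; ring
      simp only [hlast, add_zero, zero_mul] at hstep
      exact hstep
    · have hlast : ∑ t ∈ Icc 1 T, ℐ t i = S T i := by rw [hS, hlen, h1]; ring
      simp only [hlast] at hr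
      exact hr
  have hFW : ∀ i, F (S T i) (G i) ≤ W i := by
    intro i
    obtain ⟨g, b, hg, hb, hGi, hWi⟩ := (hrun i).exists_sequences
    rw [hGi, hWi]
    exact hWealth (S T i) (by rw [hS]; omega) g b hg hb
  have hkl := sum_mul_log_le_sum_mul_log_div π u W hπ0 hu0 hu1
    (fun i => (hFpos _ _).trans_le (hFW i)) hπW
  have hpot : c₁ * (∑ i, u i * (G i ^ 2 / S T i)) + ∑ i, u i * c₂ i ≤
      ∑ i, u i * Real.log (W i) := by
    rw [mul_sum, ← sum_add_distrib]
    refine sum_le_sum fun i _ => ?_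
    have := mul_le_mul_of_nonneg_left
      ((hFlb i (G i)).trans (Real.log_le_log (hFpos _ _) (hFW i))) (hu0 i)
    calc _ = u i * (c₁ * G i ^ 2 / (S T i : ℝ) + c₂ i) := by ring
      _ ≤ _ := this
  have hSpos : ∀ i, (0 : ℝ) < S T i := fun i => by
    rw [Nat.cast_pos, hS]
    omega
  have hcs := sq_sum_mul_le_sum_mul_sq_div u G (fun i => (S T i : ℝ)) hu0 hSpos
  have hreg : ∑ t ∈ Icc 1 T, ∑ i, (ℐ t i : ℝ) * u i * (h t - ℓ t i) ≤ ∑ i, u i * G i := by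
    simp only [hG, mul_sum]
    rw [sum_comm]
    refine sum_le_sum fun i _ => sum_le_sum fun t ht => ?_
    linarith [mul_le_mul_of_nonneg_left (hgge i t ht) (hu0 i)]
  refine hreg.trans (Real.le_sqrt_of_sq_le (hcs.trans ?_))
  have hquad : ∑ i, u i * (G i ^ 2 / S T i) ≤
      c₁⁻¹ * ((∑ i, u i * Real.log (u i / π i)) - ∑ i, u i * c₂ i) := by
    rw [le_inv_mul_iff₀ hc₁]
    linarith
  calc _ ≤ (∑ i, u i * (S T i : ℝ)) *
        (c₁⁻¹ * ((∑ i, u i * Real.log (u i / π i)) - ∑ i, u i * c₂ i)) :=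
        mul_le_mul_of_nonneg_left hquad
          (sum_nonneg fun i _ => mul_nonneg (hu0 i) (hSpos i).le)
    _ = _ := by ring
end

section
/- (Regret of Sleeping CB with the Krichevsky–Trofimov potential) Run the Sleeping CB algorithm with the KT potentials with shift δ = 0, i.e., F_t(x) := 2^t·Γ((t+1+x)/2)·Γ((t+1−x)/2)/(Γ(1/2)²·Γ(t+1)). Then for every u ∈ Δ^N, Regret_T(u) ≤ sqrt( 2·(∑_{i=1}^N u_i S_{T,i})·( KL(u‖π) + (1/2)·ln T + 2 ) ). -/
/-- The Krichevsky–Trofimov potential with time shift `δ = 0`: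
`F_t(x) = 2^t·Γ((t+1+x)/2)·Γ((t+1−x)/2)/(Γ(1/2)²·Γ(t+1))`. -/
noncomputable def KTpot (t : ℕ) (x : ℝ) : ℝ :=
  2 ^ t * Real.Gamma (((t : ℝ) + 1 + x) / 2) * Real.Gamma (((t : ℝ) + 1 - x) / 2) /
    (Real.Gamma (1 / 2) ^ 2 * Real.Gamma ((t : ℝ) + 1))

theorem KTpot_pos {t : ℕ} {x : ℝ} (hx : |x| < t + 1) : 0 < KTpot t x := by
  obtain ⟨h1, h2⟩ := abs_lt.mp hx
  have := Real.Gamma_pos_of_pos (show 0 < ((t : ℝ) + 1 + x) / 2 by linarith)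
  have := Real.Gamma_pos_of_pos (show 0 < ((t : ℝ) + 1 - x) / 2 by linarith)
  have := Real.Gamma_pos_of_pos (show (0 : ℝ) < 1 / 2 by norm_num)
  have := Real.Gamma_pos_of_pos (show 0 < (t : ℝ) + 1 by positivity)
  unfold KTpot
  positivity

theorem KTpot_zero_zero : KTpot 0 0 = 1 := by
  have := Real.Gamma_pos_of_pos (show (0 : ℝ) < 1 / 2 by norm_num)
  simp only [KTpot, pow_zero, Nat.cast_zero, zero_add, add_zero, sub_zero, Real.Gamma_one, one_mul,
    mul_one]
  field_simp

/-- The potential after a winning coin flip. -/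
theorem KTpot_succ_add_one {n : ℕ} {x : ℝ} (hx : |x| < n + 1) :
    KTpot (n + 1) (x + 1) = (1 + x / (n + 1)) * KTpot n x := by
  obtain ⟨h1, h2⟩ := abs_lt.mp hx
  have hg := (Real.Gamma_pos_of_pos (show (0 : ℝ) < 1 / 2 by norm_num)).ne'
  have hn : (0 : ℝ) < n + 1 := by positivity
  have hgn := (Real.Gamma_pos_of_pos hn).ne'
  have e1 : Real.Gamma (((n + 1 : ℕ) + 1 + (x + 1)) / 2) =
      (((n : ℝ) + 1 + x) / 2) * Real.Gamma (((n : ℝ) + 1 + x) / 2) := by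
    rw [← Real.Gamma_add_one (by linarith)]; congr 1; push_cast; ring
  have e2 : (((n + 1 : ℕ) : ℝ) + 1 - (x + 1)) / 2 = ((n : ℝ) + 1 - x) / 2 := by push_cast; ring
  have e3 : Real.Gamma (((n + 1 : ℕ) : ℝ) + 1) = ((n : ℝ) + 1) * Real.Gamma ((n : ℝ) + 1) := by
    rw [← Real.Gamma_add_one hn.ne']; push_cast; rfl
  unfold KTpot
  rw [e1, e2, e3]
  field_simp
  ring

theorem KTpot_neg (n : ℕ) (x : ℝ) : KTpot n (-x) = KTpot n x := by
  simp only [KTpot, sub_neg_eq_add, ← sub_eq_add_neg]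
  ring

/-- The potential after a losing coin flip. -/
theorem KTpot_succ_sub_one {n : ℕ} {x : ℝ} (hx : |x| < n + 1) :
    KTpot (n + 1) (x - 1) = (1 - x / (n + 1)) * KTpot n x := by
  have := KTpot_succ_add_one (n := n) (x := -x) (by rwa [abs_neg])
  rw [KTpot_neg, show -x + 1 = -(x - 1) by ring, KTpot_neg] at this
  rw [this]; ring

theorem convexOn_KTpot (n : ℕ) : ConvexOn ℝ (Set.Ioo (-((n : ℝ) + 1)) (n + 1)) (KTpot n) := by
  refine convexOn_iff_forall_pos.mpr ⟨convex_Ioo _ _, ?_⟩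
  rintro x ⟨hx1, hx2⟩ y ⟨hy1, hy2⟩ a b ha hb hab
  have px1 : 0 < ((n : ℝ) + 1 + x) / 2 := by linarith
  have px2 : 0 < ((n : ℝ) + 1 - x) / 2 := by linarith
  have py1 : 0 < ((n : ℝ) + 1 + y) / 2 := by linarith
  have py2 : 0 < ((n : ℝ) + 1 - y) / 2 := by linarith
  have k1 := Real.Gamma_mul_add_mul_le_rpow_Gamma_mul_rpow_Gamma px1 py1 ha hb hab
  have k2 := Real.Gamma_mul_add_mul_le_rpow_Gamma_mul_rpow_Gamma px2 py2 ha hb hab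
  have gx1 := Real.Gamma_pos_of_pos px1
  have gx2 := Real.Gamma_pos_of_pos px2
  have gy1 := Real.Gamma_pos_of_pos py1
  have gy2 := Real.Gamma_pos_of_pos py2
  have key : Real.Gamma (((n : ℝ) + 1 + (a * x + b * y)) / 2) *
      Real.Gamma (((n : ℝ) + 1 - (a * x + b * y)) / 2) ≤
      a * (Real.Gamma (((n : ℝ) + 1 + x) / 2) * Real.Gamma (((n : ℝ) + 1 - x) / 2)) +
      b * (Real.Gamma (((n : ℝ) + 1 + y) / 2) * Real.Gamma (((n : ℝ) + 1 - y) / 2)) := by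
    refine le_trans ?_ (Real.geom_mean_le_arith_mean2_weighted ha.le hb.le
      (mul_pos gx1 gx2).le (mul_pos gy1 gy2).le hab)
    rw [Real.mul_rpow gx1.le gx2.le, Real.mul_rpow gy1.le gy2.le, mul_mul_mul_comm]
    have e1 : ((n : ℝ) + 1 + (a * x + b * y)) / 2 =
        a * (((n : ℝ) + 1 + x) / 2) + b * (((n : ℝ) + 1 + y) / 2) := by
      linear_combination (-((n : ℝ) + 1) / 2) * hab
    have e2 : ((n : ℝ) + 1 - (a * x + b * y)) / 2 =
        a * (((n : ℝ) + 1 - x) / 2) + b * (((n : ℝ) + 1 - y) / 2) := by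
      linear_combination (-((n : ℝ) + 1) / 2) * hab
    rw [e1, e2]
    exact mul_le_mul k1 k2 (Real.Gamma_nonneg_of_nonneg (by positivity)) (by positivity)
  have hg := Real.Gamma_pos_of_pos (show (0 : ℝ) < 1 / 2 by norm_num)
  have hgn := Real.Gamma_pos_of_pos (show 0 < (n : ℝ) + 1 by positivity)
  have hc : (0 : ℝ) ≤ 2 ^ n / (Real.Gamma (1 / 2) ^ 2 * Real.Gamma ((n : ℝ) + 1)) := by positivity
  have := mul_le_mul_of_nonneg_left key hc
  simp only [KTpot, smul_eq_mul]
  convert this using 1 <;> ring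

theorem KTpot_betting_fraction {n : ℕ} {x : ℝ} (hx : |x| < n + 1) :
    (KTpot (n + 1) (x + 1) - KTpot (n + 1) (x - 1)) /
      (KTpot (n + 1) (x + 1) + KTpot (n + 1) (x - 1)) = x / (n + 1) := by
  have := KTpot_pos hx
  rw [KTpot_succ_add_one hx, KTpot_succ_sub_one hx]
  field_simp
  ring

/-- One round of coin betting with the KT potential. -/
theorem KTpot_succ_le {n : ℕ} {x g : ℝ} (hx : |x| < n + 1) (hg : |g| ≤ 1) :
    KTpot (n + 1) (x + g) ≤ (1 + x / (n + 1) * g) * KTpot n x := by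
  obtain ⟨h1, h2⟩ := abs_lt.mp hx
  obtain ⟨g1, g2⟩ := abs_le.mp hg
  have hx1 : x + 1 ∈ Set.Ioo (-(((n + 1 : ℕ) : ℝ) + 1)) ((n + 1 : ℕ) + 1) :=
    ⟨by push_cast; linarith, by push_cast; linarith⟩
  have hx2 : x - 1 ∈ Set.Ioo (-(((n + 1 : ℕ) : ℝ) + 1)) ((n + 1 : ℕ) + 1) :=
    ⟨by push_cast; linarith, by push_cast; linarith⟩
  have := (convexOn_KTpot (n + 1)).2 hx1 hx2 (show 0 ≤ (1 + g) / 2 by linarith)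
    (show 0 ≤ (1 - g) / 2 by linarith) (by ring)
  rw [KTpot_succ_add_one hx, KTpot_succ_sub_one hx] at this
  simp only [smul_eq_mul] at this
  rw [show (1 + g) / 2 * (x + 1) + (1 - g) / 2 * (x - 1) = x + g by ring] at this
  refine this.trans (le_of_eq ?_)
  ring

theorem mul_log_add_mul_log_ge_of_nonneg {q : ℝ} (h0 : 0 ≤ q) (h1 : q ≤ 1) :
    q ^ 2 ≤ (1 + q) * Real.log (1 + q) + (1 - q) * Real.log (1 - q) := by
  have hmono : MonotoneOn (fun q : ℝ => (1 + q) * Real.log (1 + q) +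
      (1 - q) * Real.log (1 - q) - q ^ 2) (Set.Icc 0 1) := by
    refine monotoneOn_of_deriv_nonneg (convex_Icc _ _) ?_ ?_ ?_
    · have := Real.continuous_mul_log
      exact (((this.comp (continuous_const.add continuous_id)).add
        (this.comp (continuous_const.sub continuous_id))).sub (continuous_pow 2)).continuousOn
    · rw [interior_Icc]
      rintro x ⟨hx0, hx1⟩
      have a1 : 1 + x ≠ 0 := by linarith
      have a2 : 1 - x ≠ 0 := by linarith
      apply DifferentiableAt.differentiableWithinAt
      fun_prop (disch := assumption)
    · rw [interior_Icc]
      rintro x ⟨hx0, hx1⟩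
      have a1 : 1 + x ≠ 0 := by linarith
      have a2 : 1 - x ≠ 0 := by linarith
      have d1 := (Real.hasDerivAt_mul_log a1).comp x ((hasDerivAt_id x).const_add 1)
      have d2 := (Real.hasDerivAt_mul_log a2).comp x ((hasDerivAt_id x).const_sub 1)
      have d := (d1.add d2).sub (hasDerivAt_pow 2 x)
      have hd := d.deriv
      have hq : 0 < 1 - x := by linarith
      have key := Real.le_log_one_add_of_nonneg (x := 2 * x / (1 - x)) (by positivity)
      have e1 : 2 * (2 * x / (1 - x)) / (2 * x / (1 - x) + 2) = 2 * x := by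
        rw [show 2 * x / (1 - x) + 2 = 2 / (1 - x) by field_simp; ring]
        field_simp
      have e2 : 1 + 2 * x / (1 - x) = (1 + x) / (1 - x) := by field_simp; ring
      rw [e1, e2, Real.log_div a1 a2] at key
      refine le_of_le_of_eq ?_ hd.symm
      simp only [Nat.cast_ofNat]
      norm_num
      linarith
  have := hmono (Set.left_mem_Icc.mpr zero_le_one) ⟨h0, h1⟩ h0
  norm_num at this
  linarith

theorem mul_log_add_mul_log_ge {q : ℝ} (hq : |q| ≤ 1) :
    q ^ 2 ≤ (1 + q) * Real.log (1 + q) + (1 - q) * Real.log (1 - q) := by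
  rcases le_total 0 q with h | h
  · exact mul_log_add_mul_log_ge_of_nonneg h (abs_le.mp hq).2
  · have := mul_log_add_mul_log_ge_of_nonneg (q := -q) (by linarith)
      (by linarith [(abs_le.mp hq).1])
    rw [neg_sq, sub_neg_eq_add, ← sub_eq_add_neg] at this
    linarith

/-- The midpoint inequality for the concave function `log` on `[y, y + 1]`. -/
theorem add_one_mul_log_sub_le {y : ℝ} (hy : 0 ≤ y) :
    (y + 1) * Real.log (y + 1) - y * Real.log y - 1 ≤ Real.log (y + 1 / 2) := by
  have hm : 0 < y + 1 / 2 := by linarith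
  have h1 : ∫ s in y..(y + 1), Real.log s = (y + 1) * Real.log (y + 1) - y * Real.log y - 1 := by
    rw [integral_log]; ring
  have h2 : ∫ s in y..(y + 1), (Real.log (y + 1 / 2) + (s - (y + 1 / 2)) * (y + 1 / 2)⁻¹) =
      Real.log (y + 1 / 2) := by
    rw [intervalIntegral.integral_add (Continuous.intervalIntegrable (by fun_prop) _ _)
        (Continuous.intervalIntegrable (by fun_prop) _ _),
      intervalIntegral.integral_mul_const,
      intervalIntegral.integral_sub (Continuous.intervalIntegrable (by fun_prop) _ _)
        (Continuous.intervalIntegrable (by fun_prop) _ _)]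
    simp
    left
    ring
  rw [← h1, ← h2]
  refine intervalIntegral.integral_mono_on_of_le_Ioo (by linarith)
    intervalIntegral.intervalIntegrable_log' (Continuous.intervalIntegrable (by fun_prop) _ _) ?_
  rintro s ⟨hs, -⟩
  have hs0 : 0 < s := by linarith
  have := Real.log_le_sub_one_of_pos (div_pos hs0 hm)
  rw [Real.log_div hs0.ne' hm.ne'] at this
  have e : s / (y + 1 / 2) - 1 = (s - (y + 1 / 2)) * (y + 1 / 2)⁻¹ := by field_simp
  linarith

theorem log_pi_le : Real.log Real.pi ≤ 1.15 := by
  rw [Real.log_le_iff_le_exp Real.pi_pos]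
  have h1 := Real.exp_one_gt_d9
  have h2 := Real.quadratic_le_exp_of_nonneg (x := 0.15) (by norm_num)
  have h3 := Real.pi_lt_d4
  rw [show (1.15 : ℝ) = 1 + 0.15 by norm_num, Real.exp_add]
  nlinarith

theorem log_Gamma_add_half_ge_of_le_one {y : ℝ} (hy : 0 ≤ y) (hy1 : y ≤ 1) :
    (Real.log Real.pi - 1) / 2 + y * Real.log y - y ≤ Real.log (Real.Gamma (y + 1 / 2)) := by
  have hylog : y * Real.log y ≤ 0 := Real.mul_log_nonpos hy hy1
  have hπ := log_pi_le
  have h2 := Real.log_two_gt_d9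
  have hlogπ : 0 < Real.log Real.pi := Real.log_pos (by linarith [Real.pi_gt_three])
  have g12 : Real.log (Real.Gamma (1 / 2)) = Real.log Real.pi / 2 := by
    rw [Real.Gamma_one_half_eq, Real.log_sqrt Real.pi_pos.le]
  have g32 : Real.log (Real.Gamma (3 / 2)) = Real.log Real.pi / 2 - Real.log 2 := by
    rw [show (3 / 2 : ℝ) = 1 / 2 + 1 by norm_num, Real.Gamma_add_one (by norm_num),
      Real.log_mul (by norm_num) (Real.Gamma_pos_of_pos (by norm_num)).ne', g12, one_div,
      Real.log_inv]
    ring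
  rcases lt_trichotomy y (1 / 2) with h | rfl | h
  · have := Real.convexOn_log_Gamma.slope_mono_adjacent (x := y + 1 / 2) (y := 1) (z := 3 / 2)
      (by simp only [Set.mem_Ioi]; linarith) (by simp only [Set.mem_Ioi]; norm_num)
      (by linarith) (by norm_num)
    simp only [Function.comp, Real.Gamma_one, Real.log_one, g32] at this
    rw [div_le_iff₀ (by linarith)] at this
    norm_num at this
    norm_num
    nlinarith
  · norm_num at hylog ⊢
    linarith
  · have := Real.convexOn_log_Gamma.slope_mono_adjacent (x := 1 / 2) (y := 1) (z := y + 1 / 2)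
      (by simp only [Set.mem_Ioi]; norm_num) (by simp only [Set.mem_Ioi]; linarith)
      (by norm_num) (by linarith)
    simp only [Function.comp, Real.Gamma_one, Real.log_one, g12] at this
    rw [le_div_iff₀ (by linarith)] at this
    norm_num at this
    norm_num
    nlinarith

theorem log_Gamma_add_half_ge {y : ℝ} (hy : 0 ≤ y) :
    (Real.log Real.pi - 1) / 2 + y * Real.log y - y ≤ Real.log (Real.Gamma (y + 1 / 2)) := by
  obtain ⟨k, hk⟩ := exists_nat_ge y
  induction k generalizing y with
  | zero => exact log_Gamma_add_half_ge_of_le_one hy (hk.trans (by norm_num))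
  | succ k ih =>
    rcases le_total y 1 with h | h
    · exact log_Gamma_add_half_ge_of_le_one hy h
    have hy' : 0 ≤ y - 1 := by linarith
    have h1 := ih hy' (by push_cast at hk; linarith)
    have h2 := add_one_mul_log_sub_le hy'
    have h3 : 0 < y - 1 + 1 / 2 := by linarith
    have h4 : Real.log (Real.Gamma (y + 1 / 2)) =
        Real.log (y - 1 + 1 / 2) + Real.log (Real.Gamma (y - 1 + 1 / 2)) := by
      rw [← Real.log_mul h3.ne' (Real.Gamma_pos_of_pos h3).ne', ← Real.Gamma_add_one h3.ne']
      congr 2; ring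
    rw [sub_add_cancel] at h2
    linarith

theorem log_factorial_le {n : ℕ} (hn : 1 ≤ n) :
    Real.log (n.factorial) ≤ 1 + 1 / 2 * Real.log n + n * Real.log n - n := by
  obtain ⟨m, rfl⟩ := Nat.exists_eq_add_of_le' hn
  have h := Stirling.stirlingSeq'_antitone (Nat.zero_le m)
  simp only [Function.comp, Nat.succ_eq_add_one, zero_add] at h
  have hpos := Stirling.stirlingSeq'_pos m
  have h' := Real.log_le_log hpos h
  rw [Stirling.log_stirlingSeq_formula, Stirling.stirlingSeq_one,
    Real.log_div (Real.exp_ne_zero _) (by positivity), Real.log_exp,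
    Real.log_sqrt (by norm_num), Real.log_mul (by norm_num) (by positivity),
    Real.log_div (by positivity) (Real.exp_ne_zero _), Real.log_exp] at h'
  linarith

theorem log_KTpot_ge {n : ℕ} (hn : 1 ≤ n) {x : ℝ} (hx : |x| ≤ n) :
    x ^ 2 / (2 * n) - 1 / 2 * Real.log n - 2 ≤ Real.log (KTpot n x) := by
  obtain ⟨h1, h2⟩ := abs_le.mp hx
  have hn0 : (0 : ℝ) < n := by exact_mod_cast hn
  have k1 := log_Gamma_add_half_ge (y := (n + x) / 2) (by linarith)
  have k2 := log_Gamma_add_half_ge (y := (n - x) / 2) (by linarith)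
  rw [show ((n : ℝ) + x) / 2 + 1 / 2 = ((n : ℝ) + 1 + x) / 2 by ring] at k1
  rw [show ((n : ℝ) - x) / 2 + 1 / 2 = ((n : ℝ) + 1 - x) / 2 by ring] at k2
  have k3 := log_factorial_le hn
  have k4 := mul_log_add_mul_log_ge (q := x / n)
    (by rw [abs_div, abs_of_pos hn0, div_le_one hn0]; exact hx)
  have hlog : ∀ r : ℝ, (n / 2 * (1 + r)) * Real.log (n / 2 * (1 + r)) =
      n / 2 * ((1 + r) * (Real.log n - Real.log 2)) + n / 2 * ((1 + r) * Real.log (1 + r)) := by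
    intro r
    rcases eq_or_ne (1 + r) 0 with h | h
    · simp [h]
    · rw [Real.log_mul (by positivity) h, Real.log_div hn0.ne' two_ne_zero]; ring
  have l1 := hlog (x / n)
  have l2 := hlog (-(x / n))
  rw [show (n : ℝ) / 2 * (1 + x / n) = (n + x) / 2 by field_simp] at l1
  rw [show (n : ℝ) / 2 * (1 + -(x / n)) = (n - x) / 2 by field_simp; ring] at l2
  have k5 : x ^ 2 / (2 * n) = n / 2 * (x / n) ^ 2 := by field_simp
  have k6 := mul_le_mul_of_nonneg_left k4 (show (0 : ℝ) ≤ n / 2 by positivity)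
  have g1 := (Real.Gamma_pos_of_pos (show 0 < ((n : ℝ) + 1 + x) / 2 by linarith)).ne'
  have g2 := (Real.Gamma_pos_of_pos (show 0 < ((n : ℝ) + 1 - x) / 2 by linarith)).ne'
  unfold KTpot
  rw [Real.Gamma_nat_eq_factorial, Real.Gamma_one_half_eq, Real.sq_sqrt Real.pi_pos.le,
    Real.log_div (by positivity) (by positivity), Real.log_mul (by positivity) g2,
    Real.log_mul (by positivity) g1, Real.log_mul Real.pi_pos.ne' (by positivity), Real.log_pow]
  rw [← sub_eq_add_neg] at l2
  rw [l1] at k1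
  rw [l2] at k2
  rw [k5]
  linarith

/-- The variational (Gibbs) inequality, one coordinate at a time. -/
theorem mul_log_le_mul_log_div_add {u p F : ℝ} (hu : 0 ≤ u) (hp : 0 < p) (hF : 0 < F) :
    u * Real.log F ≤ u * Real.log (u / p) + p * F - u := by
  rcases hu.eq_or_lt with rfl | hu
  · simp; positivity
  have := mul_le_mul_of_nonneg_left
    (Real.log_le_sub_one_of_pos (show 0 < p * F / u by positivity)) hu.le
  rw [Real.log_div (by positivity) hu.ne', Real.log_mul hp.ne' hF.ne', mul_sub u (p * F / u),
    mul_div_cancel₀ _ hu.ne'] at this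
  rw [Real.log_div hu.ne' hp.ne']
  linarith

/-- A normalized weight vector makes the average instantaneous regret vanish. -/
theorem sum_mul_weighted_mean_sub {ι : Type*} [Fintype ι] {q p l : ι → ℝ} {c m : ℝ}
    (hq : ∀ i, q i = c * p i) (hp : ∑ i, p i = 1) (hm : m = ∑ i, p i * l i) :
    ∑ i, q i * (m - l i) = 0 := by
  simp_rw [hq, mul_sub, Finset.sum_sub_distrib, mul_assoc, ← Finset.mul_sum, ← Finset.sum_mul]
  rw [hp, ← hm]
  ring

/-- **Regret of Sleeping CB with the KT potential.** Running the Sleeping CB algorithm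
with the KT potentials with shift `δ = 0` gives, for every `u ∈ Δ^N`,
`Regret_T(u) ≤ √( 2·(∑ u_i S_{T,i})·(KL(u‖π) + (1/2)·ln T + 2) )`. -/
theorem sleeping_cb_kt_regret (N T : ℕ) (hN : 0 < N) (hT : 0 < T)
    (π : Fin N → ℝ) (hπ0 : ∀ i, 0 < π i) (hπ1 : ∑ i, π i = 1)
    (ℐ : ℕ → Fin N → ℕ) (hI01 : ∀ t i, ℐ t i ≤ 1)
    (hIpos : ∀ t ∈ Finset.Icc 1 T, 0 < ∑ i, π i * (ℐ t i : ℝ))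
    (ℓ : ℕ → Fin N → ℝ) (hℓ : ∀ t i, ℓ t i ∈ Set.Icc (0 : ℝ) 1)
    -- the quantities computed by the Sleeping CB algorithm with the KT potential
    (S : ℕ → Fin N → ℕ)
    (hS : ∀ t i, S t i = 1 + ∑ τ ∈ Finset.Icc 1 (t - 1), ℐ τ i)
    (w gt : ℕ → Fin N → ℝ) (p : ℕ → Fin N → ℝ) (h : ℕ → ℝ)
    (hw : ∀ t ∈ Finset.Icc 1 T, ∀ i, w t i =
      (KTpot (S t i) ((∑ τ ∈ Finset.Icc 1 (t - 1), (ℐ τ i : ℝ) * gt τ i) + 1) -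
          KTpot (S t i) ((∑ τ ∈ Finset.Icc 1 (t - 1), (ℐ τ i : ℝ) * gt τ i) - 1)) /
        (KTpot (S t i) ((∑ τ ∈ Finset.Icc 1 (t - 1), (ℐ τ i : ℝ) * gt τ i) + 1) +
          KTpot (S t i) ((∑ τ ∈ Finset.Icc 1 (t - 1), (ℐ τ i : ℝ) * gt τ i) - 1)) *
        (1 + ∑ τ ∈ Finset.Icc 1 (t - 1), (ℐ τ i : ℝ) * gt τ i * w τ i))
    (hp : ∀ t ∈ Finset.Icc 1 T, ∀ i, p t i =
      if 0 < ∑ j, π j * (ℐ t j : ℝ) * max (w t j) 0 then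
        π i * (ℐ t i : ℝ) * max (w t i) 0 / ∑ j, π j * (ℐ t j : ℝ) * max (w t j) 0
      else π i * (ℐ t i : ℝ) / ∑ j, π j * (ℐ t j : ℝ))
    (hh : ∀ t ∈ Finset.Icc 1 T, h t = ∑ i, p t i * ℓ t i)
    (hgt : ∀ t ∈ Finset.Icc 1 T, ∀ i, gt t i =
      if ℐ t i = 0 then 0
      else if 0 < w t i then h t - ℓ t i else max (h t - ℓ t i) 0)
    -- the comparator
    (u : Fin N → ℝ) (hu0 : ∀ i, 0 ≤ u i) (hu1 : ∑ i, u i = 1) :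
    ∑ t ∈ Finset.Icc 1 T, ∑ i, (ℐ t i : ℝ) * u i * (h t - ℓ t i) ≤
      Real.sqrt (2 * (∑ i, u i * (S T i : ℝ)) *
        ((∑ i, u i * Real.log (u i / π i)) + 1 / 2 * Real.log T + 2)) := by
  -- the predictions are probability vectors, so the losses are in `[0, 1]`
  have hp01 : ∀ t ∈ Finset.Icc 1 T, (∀ i, 0 ≤ p t i) ∧ ∑ i, p t i = 1 := by
    intro t ht
    have hq : ∀ i, 0 ≤ π i * (ℐ t i : ℝ) * max (w t i) 0 := fun i =>
      mul_nonneg (mul_nonneg (hπ0 i).le (Nat.cast_nonneg _)) (le_max_right _ _)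
    simp_rw [hp t ht]
    split_ifs with hpos
    · exact ⟨fun i => div_nonneg (hq i) hpos.le,
        by rw [← Finset.sum_div, div_self hpos.ne']⟩
    · exact ⟨fun i => div_nonneg (mul_nonneg (hπ0 i).le (Nat.cast_nonneg _)) (hIpos t ht).le,
        by rw [← Finset.sum_div, div_self (hIpos t ht).ne']⟩
  have hh01 : ∀ t ∈ Finset.Icc 1 T, 0 ≤ h t ∧ h t ≤ 1 := by
    intro t ht
    obtain ⟨h0, h1⟩ := hp01 t ht
    rw [hh t ht]
    refine ⟨Finset.sum_nonneg fun i _ => mul_nonneg (h0 i) (hℓ t i).1, ?_⟩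
    rw [← h1]
    exact Finset.sum_le_sum fun i _ => mul_le_of_le_one_right (h0 i) (hℓ t i).2
  have hgt1 : ∀ t ∈ Finset.Icc 1 T, ∀ i, |gt t i| ≤ 1 := by
    intro t ht i
    obtain ⟨h0, h1⟩ := hh01 t ht
    obtain ⟨l0, l1⟩ := hℓ t i
    have : |h t - ℓ t i| ≤ 1 := abs_le.mpr ⟨by linarith, by linarith⟩
    rw [hgt t ht]
    split_ifs
    · simp
    · exact this
    · rw [abs_of_nonneg (le_max_right _ _)]
      exact max_le (by linarith) zero_le_one
  have hgt_ge : ∀ t ∈ Finset.Icc 1 T, ∀ i,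
      (ℐ t i : ℝ) * (h t - ℓ t i) ≤ (ℐ t i : ℝ) * gt t i := by
    intro t ht i
    rw [hgt t ht]
    split_ifs with hI
    · simp [hI]
    · exact le_rfl
    · exact mul_le_mul_of_nonneg_left (le_max_left _ _) (Nat.cast_nonneg _)
  -- the mixture of the bettors does not gain money
  have hround : ∀ t ∈ Finset.Icc 1 T, ∑ i, π i * ((ℐ t i : ℝ) * gt t i * w t i) ≤ 0 := by
    intro t ht
    have hle : ∑ i, π i * ((ℐ t i : ℝ) * gt t i * w t i) ≤
        ∑ i, π i * (ℐ t i : ℝ) * max (w t i) 0 * (h t - ℓ t i) := by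
      refine Finset.sum_le_sum fun i _ => ?_
      rw [hgt t ht]
      split_ifs with hI hw0
      · simp [hI]
      · rw [max_eq_left hw0.le]
        exact le_of_eq (by ring)
      · rw [not_lt] at hw0
        rw [max_eq_right hw0, mul_zero, zero_mul, mul_assoc]
        exact mul_nonpos_of_nonneg_of_nonpos (hπ0 i).le
          (mul_nonpos_of_nonneg_of_nonpos (Nat.cast_nonneg _)
            (mul_nonpos_of_nonneg_of_nonpos (le_max_right _ _) hw0))
    refine hle.trans (le_of_eq ?_)
    have hq : ∀ i, 0 ≤ π i * (ℐ t i : ℝ) * max (w t i) 0 := fun i =>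
      mul_nonneg (mul_nonneg (hπ0 i).le (Nat.cast_nonneg _)) (le_max_right _ _)
    by_cases hpos : 0 < ∑ j, π j * (ℐ t j : ℝ) * max (w t j) 0
    · refine sum_mul_weighted_mean_sub (c := ∑ j, π j * (ℐ t j : ℝ) * max (w t j) 0)
        (fun i => ?_) (hp01 t ht).2 (hh t ht)
      rw [hp t ht, if_pos hpos, mul_div_cancel₀ _ hpos.ne']
    · have hz := (Finset.sum_eq_zero_iff_of_nonneg fun i _ => hq i).mp
        (le_antisymm (not_lt.mp hpos) (Finset.sum_nonneg fun i _ => hq i))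
      exact Finset.sum_eq_zero fun i hi => by rw [hz i hi, zero_mul]
  -- the wealth of each bettor dominates the potential
  have hwealth : ∀ i, ∀ m ≤ T,
      |∑ τ ∈ Finset.Icc 1 m, (ℐ τ i : ℝ) * gt τ i| ≤ (∑ τ ∈ Finset.Icc 1 m, ℐ τ i : ℕ) ∧
      KTpot (∑ τ ∈ Finset.Icc 1 m, ℐ τ i) (∑ τ ∈ Finset.Icc 1 m, (ℐ τ i : ℝ) * gt τ i) ≤
        1 + ∑ τ ∈ Finset.Icc 1 m, (ℐ τ i : ℝ) * gt τ i * w τ i := by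
    intro i m hm
    induction m with
    | zero => simp [KTpot_zero_zero]
    | succ m ih =>
      obtain ⟨ih1, ih2⟩ := ih (by omega)
      have ht : m + 1 ∈ Finset.Icc 1 T := Finset.mem_Icc.mpr ⟨by omega, hm⟩
      simp only [Finset.sum_Icc_succ_top (Nat.le_add_left 1 m)]
      have hw' := hw (m + 1) ht i
      rw [hS, Nat.add_sub_cancel, add_comm 1 (∑ τ ∈ Finset.Icc 1 m, ℐ τ i)] at hw'
      set n := ∑ τ ∈ Finset.Icc 1 m, ℐ τ i
      set z := ∑ τ ∈ Finset.Icc 1 m, (ℐ τ i : ℝ) * gt τ i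
      set W := 1 + ∑ τ ∈ Finset.Icc 1 m, (ℐ τ i : ℝ) * gt τ i * w τ i with hW
      have hz : |z| < n + 1 := by linarith
      have hg := hgt1 (m + 1) ht i
      rw [KTpot_betting_fraction hz] at hw'
      rcases Nat.le_one_iff_eq_zero_or_eq_one.mp (hI01 (m + 1) i) with hI | hI
      · rw [hI]
        simpa using ⟨ih1, ih2⟩
      · rw [hI]
        simp only [Nat.cast_one, one_mul]
        refine ⟨(abs_add_le _ _).trans (by push_cast; linarith), ?_⟩
        refine (KTpot_succ_le hz hg).trans ?_
        have hβ : |z / (n + 1) * gt (m + 1) i| ≤ 1 := by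
          rw [abs_mul, abs_div, abs_of_pos (show (0 : ℝ) < n + 1 by positivity)]
          exact mul_le_one₀ ((div_le_one (by positivity)).mpr hz.le) (abs_nonneg _) hg
        refine (mul_le_mul_of_nonneg_left ih2 (by linarith [(abs_le.mp hβ).1])).trans
          (le_of_eq ?_)
        rw [← add_assoc, ← hW, hw']
        ring
  set n : Fin N → ℕ := fun i => ∑ τ ∈ Finset.Icc 1 T, ℐ τ i with hn
  set z : Fin N → ℝ := fun i => ∑ τ ∈ Finset.Icc 1 T, (ℐ τ i : ℝ) * gt τ i with hz
  have hzn : ∀ i, |z i| ≤ n i := fun i => (hwealth i T le_rfl).1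
  have hF0 : ∀ i, 0 < KTpot (n i) (z i) := fun i => KTpot_pos (by linarith [hzn i])
  have hmix : ∑ i, π i * KTpot (n i) (z i) ≤ 1 := by
    calc ∑ i, π i * KTpot (n i) (z i)
        ≤ ∑ i, π i * (1 + ∑ τ ∈ Finset.Icc 1 T, (ℐ τ i : ℝ) * gt τ i * w τ i) :=
          Finset.sum_le_sum fun i _ =>
            mul_le_mul_of_nonneg_left (hwealth i T le_rfl).2 (hπ0 i).le
      _ = 1 + ∑ τ ∈ Finset.Icc 1 T, ∑ i, π i * ((ℐ τ i : ℝ) * gt τ i * w τ i) := by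
          rw [Finset.sum_comm]
          simp_rw [mul_add, mul_one, Finset.sum_add_distrib, hπ1, Finset.mul_sum]
      _ ≤ 1 := by linarith [Finset.sum_nonpos hround]
  have hKL : ∑ i, u i * Real.log (KTpot (n i) (z i)) ≤ ∑ i, u i * Real.log (u i / π i) := by
    have := Finset.sum_le_sum fun i (_ : i ∈ Finset.univ) =>
      mul_log_le_mul_log_div_add (hu0 i) (hπ0 i) (hF0 i)
    rw [Finset.sum_sub_distrib, Finset.sum_add_distrib, hu1] at this
    linarith
  have hlogT : 0 ≤ Real.log T := Real.log_natCast_nonneg T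
  have hS1 : ∀ i, 0 < (S T i : ℝ) := fun i => by
    rw [hS]; push_cast; positivity
  have hnS : ∀ i, n i ≤ S T i := by
    intro i
    obtain ⟨k, rfl⟩ := Nat.exists_eq_add_of_le' hT
    rw [hS, hn]
    simp only [Finset.sum_Icc_succ_top (Nat.le_add_left 1 k), Nat.add_sub_cancel]
    linarith [hI01 (k + 1) i]
  have hsq : ∀ i, z i ^ 2 / (S T i : ℝ) ≤
      2 * (Real.log (KTpot (n i) (z i)) + 1 / 2 * Real.log T + 2) := by
    intro i
    rcases Nat.eq_zero_or_pos (n i) with h0 | hpos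
    · have hz0 : z i = 0 := abs_nonpos_iff.mp (by simpa [h0] using hzn i)
      rw [h0, hz0, KTpot_zero_zero, Real.log_one]
      norm_num
      linarith
    · have hn0 : (0 : ℝ) < n i := by exact_mod_cast hpos
      have h1 := log_KTpot_ge hpos (hzn i)
      have h2 : z i ^ 2 / (S T i : ℝ) ≤ z i ^ 2 / n i :=
        div_le_div_of_nonneg_left (sq_nonneg _) hn0 (by exact_mod_cast hnS i)
      have h3 : Real.log (n i) ≤ Real.log T := by
        refine Real.log_le_log hn0 (Nat.cast_le.mpr ?_)
        calc n i ≤ ∑ τ ∈ Finset.Icc 1 T, 1 := Finset.sum_le_sum fun τ _ => hI01 τ i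
          _ = T := by simp
      have h4 : z i ^ 2 / (2 * n i) = z i ^ 2 / n i / 2 := by field_simp
      linarith
  have hreg : ∑ t ∈ Finset.Icc 1 T, ∑ i, (ℐ t i : ℝ) * u i * (h t - ℓ t i) ≤ ∑ i, u i * z i := by
    rw [Finset.sum_comm]
    refine Finset.sum_le_sum fun i _ => ?_
    rw [hz, Finset.mul_sum]
    refine Finset.sum_le_sum fun t ht => ?_
    have := mul_le_mul_of_nonneg_left (hgt_ge t ht i) (hu0 i)
    linarith
  refine hreg.trans (Real.le_sqrt_of_sq_le ?_)
  have hCS : (∑ i, u i * z i) ^ 2 ≤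
      (∑ i, u i * (S T i : ℝ)) * ∑ i, u i * (z i ^ 2 / (S T i : ℝ)) := by
    refine Finset.sum_sq_le_sum_mul_sum_of_sq_le_mul _
      (fun i _ => mul_nonneg (hu0 i) (hS1 i).le)
      (fun i _ => mul_nonneg (hu0 i) (div_nonneg (sq_nonneg _) (hS1 i).le)) fun i _ => ?_
    have := (hS1 i).ne'
    exact le_of_eq (by field_simp)
  have hsum : ∑ i, u i * (z i ^ 2 / (S T i : ℝ)) ≤
      2 * ((∑ i, u i * Real.log (u i / π i)) + 1 / 2 * Real.log T + 2) := by
    have := Finset.sum_le_sum fun i (_ : i ∈ Finset.univ) =>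
      mul_le_mul_of_nonneg_left (hsq i) (hu0 i)
    have e : ∑ i, u i * (2 * (Real.log (KTpot (n i) (z i)) + 1 / 2 * Real.log T + 2)) =
        2 * ∑ i, u i * Real.log (KTpot (n i) (z i)) +
          (∑ i, u i) * (Real.log T + 4) := by
      rw [Finset.mul_sum, Finset.sum_mul, ← Finset.sum_add_distrib]
      exact Finset.sum_congr rfl fun i _ => by ring
    rw [hu1] at e
    linarith
  refine hCS.trans ((mul_le_mul_of_nonneg_left hsum
    (Finset.sum_nonneg fun i _ => mul_nonneg (hu0 i) (hS1 i).le)).trans (le_of_eq ?_))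
  ring
end

section
/- (Meta regret of CBCE) Assume each loss function f_t : 𝒟 → [0,1] is convex. Then the CBCE algorithm run with prior π̄ and the KT potential with δ = 0 satisfies, for every geometric covering interval J = [J₁..J₂] ∈ 𝒥 with J₂ ≤ T and for arbitrary black-box decisions x_t^{B_J} ∈ 𝒟 (t ∈ J): ∑_{t∈J} ( f_t(x_t) − f_t(x_t^{B_J}) ) ≤ sqrt( |J| · (7·ln(J₂) + 5) ). -/
open scoped Classical

/-- The (finite) collection of geometric covering intervals containing time `t`. -/
noncomputable def Active (t : ℕ) : Finset (ℕ × ℕ) :=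
  (Finset.Icc 1 t ×ˢ Finset.Icc t (2 * t)).filter fun q => isGC q.1 q.2 ∧ q.1 ≤ t ∧ t ≤ q.2

/-! ### The Krichevsky–Trofimov bettor -/

lemma two_div_le_log_succ_sub_log {u : ℝ} (hu : 0 < u) :
    1 / (u + 1 / 2) ≤ Real.log (u + 1) - Real.log u := by
  have h := Real.le_log_one_add_of_nonneg (x := 1 / u) (by positivity)
  rw [← Real.log_div (by positivity) hu.ne']
  have e1 : (u + 1) / u = 1 + 1 / u := by field_simp
  have e2 : 1 / (u + 1 / 2) = 2 * (1 / u) / (1 / u + 2) := by field_simp; ring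
  rw [e1, e2]
  exact h

lemma monotoneOn_mul_log_succ :
    MonotoneOn (fun u : ℝ => (u + 1) * Real.log (u + 1) - u * Real.log u - Real.log (u + 1 / 2))
      (Set.Ici 0) := by
  have hder : ∀ u : ℝ, 0 < u → HasDerivAt
      (fun u : ℝ => (u + 1) * Real.log (u + 1) - u * Real.log u - Real.log (u + 1 / 2))
      ((Real.log (u + 1) + 1) - (Real.log u + 1) - 1 / (u + 1 / 2)) u := by
    intro u hu
    have h1 : HasDerivAt (fun u : ℝ => (u + 1) * Real.log (u + 1)) (Real.log (u + 1) + 1) u := by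
      simpa using (Real.hasDerivAt_mul_log (x := u + 1) (by positivity)).comp_add_const u 1
    have h2 := Real.hasDerivAt_mul_log hu.ne'
    have h3 : HasDerivAt (fun u : ℝ => Real.log (u + 1 / 2)) (1 / (u + 1 / 2)) u :=
      ((hasDerivAt_id u).add_const (1 / 2 : ℝ)).log (by simp; positivity)
    exact (h1.sub h2).sub h3
  refine monotoneOn_of_deriv_nonneg (convex_Ici 0) ?_ ?_ ?_
  · refine ContinuousOn.sub (Continuous.continuousOn ?_) ?_
    · exact (Real.continuous_mul_log.comp (continuous_add_const 1)).sub Real.continuous_mul_log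
    · refine ContinuousOn.log (by fun_prop) ?_
      intro u hu
      have : (0 : ℝ) ≤ u := hu
      positivity
  · intro u hu
    rw [interior_Ici] at hu
    exact (hder u hu).differentiableAt.differentiableWithinAt
  · intro u hu
    rw [interior_Ici] at hu
    rw [(hder u hu).deriv]
    linarith [two_div_le_log_succ_sub_log hu]

lemma sq_le_mul_log_add_mul_log {s : ℝ} (h0 : 0 ≤ s) (h1 : s ≤ 1) :
    s ^ 2 ≤ (1 + s) * Real.log (1 + s) + (1 - s) * Real.log (1 - s) := by
  have hder : ∀ u ∈ Set.Ioo (0 : ℝ) 1, HasDerivAt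
      (fun u : ℝ => (1 + u) * Real.log (1 + u) + (1 - u) * Real.log (1 - u) - u ^ 2)
      ((Real.log (1 + u) + 1) + -(Real.log (1 - u) + 1) - 2 * u) u := by
    intro u hu
    have hu0 : 0 < 1 + u := by linarith [hu.1]
    have hu1 : 0 < 1 - u := by linarith [hu.2]
    have a1 : HasDerivAt (fun u : ℝ => (1 + u) * Real.log (1 + u)) (Real.log (1 + u) + 1) u := by
      simpa using (Real.hasDerivAt_mul_log hu0.ne').comp_const_add 1 u
    have a2 : HasDerivAt (fun u : ℝ => (1 - u) * Real.log (1 - u)) (-(Real.log (1 - u) + 1)) u := by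
      simpa using (Real.hasDerivAt_mul_log hu1.ne').comp_const_sub 1 u
    have a3 : HasDerivAt (fun u : ℝ => u ^ 2) (2 * u) u := by
      simpa using hasDerivAt_pow 2 u
    exact (a1.add a2).sub a3
  have hmono : MonotoneOn
      (fun u : ℝ => (1 + u) * Real.log (1 + u) + (1 - u) * Real.log (1 - u) - u ^ 2)
      (Set.Icc 0 1) := by
    refine monotoneOn_of_deriv_nonneg (convex_Icc 0 1) (Continuous.continuousOn ?_) ?_ ?_
    · exact ((Real.continuous_mul_log.comp (continuous_const_add 1)).add
        (Real.continuous_mul_log.comp (continuous_const.sub continuous_id))).sub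
        (continuous_pow 2)
    · intro u hu
      rw [interior_Icc] at hu
      exact (hder u hu).differentiableAt.differentiableWithinAt
    · intro u hu
      rw [interior_Icc] at hu
      rw [(hder u hu).deriv]
      have hu0 : 0 < 1 + u := by linarith [hu.1]
      have hu1 : 0 < 1 - u := by linarith [hu.2]
      have h := Real.le_log_one_add_of_nonneg (x := 2 * u / (1 - u))
        (div_nonneg (by linarith [hu.1]) hu1.le)
      have e1 : 1 + 2 * u / (1 - u) = (1 + u) / (1 - u) := by field_simp; ring
      have e2 : 2 * (2 * u / (1 - u)) / (2 * u / (1 - u) + 2) = 2 * u := by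
        have : 2 * u / (1 - u) + 2 = 2 / (1 - u) := by field_simp; ring
        rw [this]; field_simp
      rw [e1, e2, Real.log_div hu0.ne' hu1.ne'] at h
      linarith
  have := hmono (Set.left_mem_Icc.2 zero_le_one) ⟨h0, h1⟩ h0
  simp only [add_zero, Real.log_one, sub_zero] at this
  linarith

/-- `u ^ u * v ^ v`, with the convention `0 ^ 0 = 1`. -/
noncomputable def selfPow (u v : ℝ) : ℝ := Real.exp (u * Real.log u + v * Real.log v)

lemma selfPow_pos (u v : ℝ) : 0 < selfPow u v := Real.exp_pos _

lemma selfPow_comm (u v : ℝ) : selfPow u v = selfPow v u := by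
  simp only [selfPow, add_comm]

lemma exp_natCast_mul_log (n : ℕ) : Real.exp ((n : ℝ) * Real.log n) = (n : ℝ) ^ n := by
  rcases Nat.eq_zero_or_pos n with rfl | hn
  · simp
  · rw [mul_comm, Real.exp_mul, Real.exp_log (by exact_mod_cast hn), Real.rpow_natCast]

lemma selfPow_succ_le {u v : ℝ} {n : ℕ} (hu : 0 ≤ u) (hun : u ≤ n) :
    selfPow (u + 1) v ≤
      selfPow u v * ((n + 1 : ℝ) ^ (n + 1) / ((n : ℝ) ^ n * (n + 1 / 2)) * (u + 1 / 2)) := by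
  have h := monotoneOn_mul_log_succ (Set.mem_Ici.2 hu) (Set.mem_Ici.2 (hu.trans hun)) hun
  simp only at h
  have hn : (0 : ℝ) < n + 1 / 2 := by positivity
  have hu' : (0 : ℝ) < u + 1 / 2 := by positivity
  have e : (n + 1 : ℝ) ^ (n + 1) / ((n : ℝ) ^ n * (n + 1 / 2)) * (u + 1 / 2) =
      Real.exp (((n + 1 : ℝ) * Real.log (n + 1) - n * Real.log n - Real.log (n + 1 / 2)) +
        Real.log (u + 1 / 2)) := by
    rw [Real.exp_add, Real.exp_sub, Real.exp_sub, Real.exp_log hn, Real.exp_log hu',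
      exp_natCast_mul_log]
    have := exp_natCast_mul_log (n + 1)
    push_cast at this
    rw [this, div_div]
  rw [e, selfPow, selfPow, ← Real.exp_add]
  apply Real.exp_le_exp.2
  linarith

lemma selfPow_convex {u v a b : ℝ} (hu : 0 ≤ u) (hv : 0 ≤ v) (ha : 0 ≤ a) (hb : 0 ≤ b)
    (hab : a + b = 1) :
    selfPow (u + a) (v + b) ≤ a * selfPow (u + 1) v + b * selfPow u (v + 1) := by
  have h1 := Real.convexOn_mul_log.2 (x := u + 1) (y := u) (by simp; linarith) (by simpa) ha hb hab
  have h2 := Real.convexOn_mul_log.2 (x := v) (y := v + 1) (by simpa) (by simp; linarith) ha hb hab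
  have h3 := convexOn_exp.2 (Set.mem_univ ((u + 1) * Real.log (u + 1) + v * Real.log v))
    (Set.mem_univ (u * Real.log u + (v + 1) * Real.log (v + 1))) ha hb hab
  simp only [smul_eq_mul] at h1 h2 h3
  have e1 : a * (u + 1) + b * u = u + a := by linear_combination u * hab
  have e2 : a * v + b * (v + 1) = v + b := by linear_combination v * hab
  rw [e1] at h1
  rw [e2] at h2
  refine le_trans (Real.exp_le_exp.2 ?_) h3
  linarith

/-- A lower bound for the wealth of the Krichevsky–Trofimov bettor after `n` rounds in which the
outcomes sum to `z`. -/
noncomputable def ktPotential (n : ℕ) (z : ℝ) : ℝ :=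
  1 / Real.sqrt (4 * n + 1) * (2 ^ n / (n : ℝ) ^ n) * selfPow ((n + z) / 2) ((n - z) / 2)

lemma natCast_pow_self_pos (n : ℕ) : (0 : ℝ) < (n : ℝ) ^ n := by
  rcases Nat.eq_zero_or_pos n with rfl | hn
  · simp
  · positivity

lemma ktPotential_pos (n : ℕ) (z : ℝ) : 0 < ktPotential n z := by
  have := natCast_pow_self_pos n
  have := selfPow_pos ((n + z) / 2) ((n - z) / 2)
  unfold ktPotential
  positivity

lemma one_div_sqrt_succ_le (n : ℕ) :
    1 / Real.sqrt (4 * (n + 1 : ℝ) + 1) ≤ 1 / Real.sqrt (4 * n + 1) * ((n + 1 / 2) / (n + 1)) := by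
  rw [← div_le_iff₀ (by positivity)]
  have e : (1 : ℝ) / Real.sqrt (4 * (n + 1 : ℝ) + 1) / ((n + 1 / 2) / (n + 1)) =
      1 / (Real.sqrt (4 * (n + 1 : ℝ) + 1) * ((n + 1 / 2) / (n + 1))) := by
    rw [div_div]
  rw [e]
  apply one_div_le_one_div_of_le (by positivity)
  apply Real.sqrt_le_iff.2 ⟨by positivity, ?_⟩
  rw [mul_pow, Real.sq_sqrt (by positivity), div_pow, mul_div_assoc', le_div_iff₀ (by positivity)]
  nlinarith

lemma ktPotential_succ_le {n : ℕ} {z g : ℝ} (hz : |z| ≤ n) (hg : |g| ≤ 1) :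
    ktPotential (n + 1) (z + g) ≤ ktPotential n z * (1 + g * z / (n + 1)) := by
  obtain ⟨hz1, hz2⟩ := abs_le.1 hz
  obtain ⟨hg1, hg2⟩ := abs_le.1 hg
  set u := ((n : ℝ) + z) / 2 with hu
  set v := ((n : ℝ) - z) / 2 with hv
  set R := (n + 1 : ℝ) ^ (n + 1) / ((n : ℝ) ^ n * (n + 1 / 2)) with hR
  have hnn := natCast_pow_self_pos n
  have hE := selfPow_pos u v
  have key : selfPow (u + (1 + g) / 2) (v + (1 - g) / 2) ≤
      selfPow u v * R * ((n + 1) / 2 * (1 + g * z / (n + 1))) := by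
    have h := selfPow_convex (u := u) (v := v) (a := (1 + g) / 2) (b := (1 - g) / 2)
      (by linarith) (by linarith) (by linarith) (by linarith) (by ring)
    have h1 := selfPow_succ_le (u := u) (v := v) (n := n) (by linarith) (by linarith)
    have h2 := selfPow_succ_le (u := v) (v := u) (n := n) (by linarith) (by linarith)
    rw [selfPow_comm (v + 1), selfPow_comm v u] at h2
    have h1' := mul_le_mul_of_nonneg_left h1 (show 0 ≤ (1 + g) / 2 by linarith)
    have h2' := mul_le_mul_of_nonneg_left h2 (show 0 ≤ (1 - g) / 2 by linarith)
    have e : selfPow u v * R * ((n + 1) / 2 * (1 + g * z / (n + 1))) =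
        (1 + g) / 2 * (selfPow u v * (R * (u + 1 / 2))) +
        (1 - g) / 2 * (selfPow u v * (R * (v + 1 / 2))) := by
      have : ((n : ℝ) + 1) / 2 * (1 + g * z / (n + 1)) = (n + 1 + g * z) / 2 := by field_simp
      rw [this, hu, hv]
      ring
    rw [e]
    linarith
  have hfac : (0 : ℝ) ≤ 1 + g * z / (n + 1) := by
    have h1 : |g * z| ≤ n := by
      rw [abs_mul]; nlinarith [abs_nonneg g, abs_nonneg z]
    have h2 := (abs_le.1 h1).1
    rw [show (1 : ℝ) + g * z / (n + 1) = (n + 1 + g * z) / (n + 1) by field_simp]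
    apply div_nonneg <;> linarith
  have eu : ((n + 1 : ℕ) + (z + g)) / 2 = u + (1 + g) / 2 := by rw [hu]; push_cast; ring
  have ev : ((n + 1 : ℕ) - (z + g)) / 2 = v + (1 - g) / 2 := by rw [hv]; push_cast; ring
  unfold ktPotential
  rw [eu, ev, ← hu, ← hv]
  push_cast
  calc 1 / Real.sqrt (4 * (n + 1 : ℝ) + 1) * (2 ^ (n + 1) / (n + 1 : ℝ) ^ (n + 1)) *
        selfPow (u + (1 + g) / 2) (v + (1 - g) / 2)
      ≤ 1 / Real.sqrt (4 * n + 1) * ((n + 1 / 2) / (n + 1)) *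
          (2 ^ (n + 1) / (n + 1 : ℝ) ^ (n + 1)) *
          (selfPow u v * R * ((n + 1) / 2 * (1 + g * z / (n + 1)))) := by
        have := one_div_sqrt_succ_le n
        have := (selfPow_pos (u + (1 + g) / 2) (v + (1 - g) / 2)).le
        gcongr
    _ = _ := by
        rw [hR]
        have : Real.sqrt (4 * (n : ℝ) + 1) ≠ 0 := by positivity
        generalize (1 + g * z / ((n : ℝ) + 1)) = F
        field_simp
        ring

/-- The wealth of the Krichevsky–Trofimov bettor dominates `ktPotential`. -/
lemma ktPotential_le_wealth {g w : ℕ → ℝ} {N : ℕ} (hg : ∀ i < N, |g i| ≤ 1)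
    (hw : ∀ i < N, w i = (∑ j ∈ Finset.range i, g j) / ((i : ℝ) + 1) *
      (1 + ∑ j ∈ Finset.range i, g j * w j)) :
    |∑ i ∈ Finset.range N, g i| ≤ N ∧
      ktPotential N (∑ i ∈ Finset.range N, g i) ≤ 1 + ∑ i ∈ Finset.range N, g i * w i := by
  induction N with
  | zero => simp [ktPotential, selfPow]
  | succ n ih =>
    obtain ⟨h1, h2⟩ := ih (fun i hi => hg i (by omega)) (fun i hi => hw i (by omega))
    have hgn := hg n (by omega)
    rw [Finset.sum_range_succ, Finset.sum_range_succ, hw n (by omega)]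
    set z := ∑ i ∈ Finset.range n, g i
    set W := ∑ i ∈ Finset.range n, g i * w i
    refine ⟨?_, ?_⟩
    · push_cast
      exact (abs_add_le _ _).trans (add_le_add h1 hgn)
    · have hfac : (0 : ℝ) ≤ 1 + g n * z / (n + 1) := by
        have := (ktPotential_pos (n + 1) (z + g n)).le.trans (ktPotential_succ_le h1 hgn)
        exact nonneg_of_mul_nonneg_right this (ktPotential_pos n z)
      calc _ ≤ ktPotential n z * (1 + g n * z / (n + 1)) := ktPotential_succ_le h1 hgn
        _ ≤ (1 + W) * (1 + g n * z / (n + 1)) := mul_le_mul_of_nonneg_right h2 hfac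
        _ = _ := by ring

lemma exp_le_ktPotential {n : ℕ} {z : ℝ} (hn : 1 ≤ n) (h0 : 0 ≤ z) (hz : z ≤ n) :
    Real.exp (z ^ 2 / (2 * n)) ≤ Real.sqrt (4 * n + 1) * ktPotential n z := by
  have hn0 : (0 : ℝ) < n := by exact_mod_cast hn
  set s := z / n with hs
  have hzs : z = n * s := by rw [hs]; field_simp
  have hs0 : 0 ≤ s := by positivity
  have hs1 : s ≤ 1 := by rw [hs, div_le_one hn0]; exact hz
  have hpin := sq_le_mul_log_add_mul_log hs0 hs1
  have hlog : ∀ r : ℝ, n * r / 2 * Real.log (n * r / 2) =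
      n / 2 * (r * (Real.log n - Real.log 2 + Real.log r)) := by
    intro r
    rcases eq_or_ne r 0 with rfl | hr
    · simp
    · rw [Real.log_div (by positivity) (by norm_num), Real.log_mul hn0.ne' hr]; ring
  have e : Real.sqrt (4 * n + 1) * ktPotential n z =
      Real.exp (n / 2 * ((1 + s) * Real.log (1 + s) + (1 - s) * Real.log (1 - s))) := by
    have e2 : (2 : ℝ) ^ n = Real.exp (n * Real.log 2) := by
      rw [mul_comm, Real.exp_mul, Real.exp_log (by norm_num), Real.rpow_natCast]
    have hsq : Real.sqrt (4 * (n : ℝ) + 1) ≠ 0 := by positivity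
    unfold ktPotential selfPow
    rw [show ((n : ℝ) + z) / 2 = n * (1 + s) / 2 by rw [hzs]; ring,
      show ((n : ℝ) - z) / 2 = n * (1 - s) / 2 by rw [hzs]; ring, hlog, hlog, e2,
      ← exp_natCast_mul_log n, ← Real.exp_sub, ← mul_assoc, ← mul_assoc, mul_one_div_cancel hsq,
      one_mul, ← Real.exp_add]
    congr 1
    ring
  rw [e]
  apply Real.exp_le_exp.2
  have : z ^ 2 / (2 * n) = n / 2 * s ^ 2 := by rw [hzs]; field_simp
  rw [this]
  gcongr

/-! ### Geometric covering intervals -/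

lemma isGC.bounds {A B : ℕ} (h : isGC A B) : 1 ≤ A ∧ A ≤ B ∧ B + 1 ≤ 2 * A := by
  obtain ⟨k, i, hi, rfl, rfl⟩ := h
  have hk : 1 ≤ 2 ^ k := Nat.one_le_two_pow
  have h1 : 1 * 2 ^ k ≤ i * 2 ^ k := Nat.mul_le_mul_right _ hi
  have h2 : (i + 1) * 2 ^ k = i * 2 ^ k + 2 ^ k := by ring
  omega

lemma mem_Active {t : ℕ} {q : ℕ × ℕ} :
    q ∈ Active t ↔ isGC q.1 q.2 ∧ q.1 ≤ t ∧ t ≤ q.2 := by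
  simp only [Active, Finset.mem_filter, Finset.mem_product, Finset.mem_Icc]
  refine ⟨fun h => h.2, fun h => ⟨?_, h⟩⟩
  have := h.1.bounds
  omega

lemma self_mem_Active {t : ℕ} (ht : 1 ≤ t) : (t, t) ∈ Active t :=
  mem_Active.2 ⟨⟨0, t, ht, by simp, by simp⟩, le_rfl, le_rfl⟩

/-- The unnormalized prior weight of an interval starting at `A`. -/
noncomputable def gcWeight (A : ℕ) : ℝ := 1 / ((A : ℝ) ^ 2 * (1 + (Nat.log 2 A : ℝ)))

lemma gcWeight_nonneg (A : ℕ) : 0 ≤ gcWeight A := by unfold gcWeight; positivity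

lemma gcWeight_pos {A : ℕ} (hA : 1 ≤ A) : 0 < gcWeight A := by
  have : (0 : ℝ) < A := by exact_mod_cast hA
  unfold gcWeight
  positivity

lemma card_isGC_le {A : ℕ} (s : Finset ℕ) (hs : ∀ B ∈ s, isGC A B) :
    s.card ≤ Nat.log 2 A + 1 := by
  have hsub : s ⊆ (Finset.range (Nat.log 2 A + 1)).image (fun k => A + 2 ^ k - 1) := by
    intro B hB
    obtain ⟨k, i, hi, hA, hB'⟩ := hs B hB
    have h1 : 1 * 2 ^ k ≤ i * 2 ^ k := Nat.mul_le_mul_right _ hi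
    have hA0 : A ≠ 0 := by have := (hs B hB).bounds; omega
    refine Finset.mem_image.2 ⟨k, ?_, ?_⟩
    · rw [Finset.mem_range, Nat.lt_succ_iff]
      exact Nat.le_log_of_pow_le (by norm_num) (by omega)
    · rw [hB', hA]; congr 1; ring
  simpa using (Finset.card_le_card hsub).trans Finset.card_image_le

lemma sum_one_div_sq_le (N : ℕ) :
    ∑ j ∈ Finset.range (N + 1), 1 / ((j : ℝ) + 1) ^ 2 ≤ 2 - 1 / ((N : ℝ) + 1) := by
  induction N with
  | zero => norm_num
  | succ n ih =>
    rw [Finset.sum_range_succ]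
    have e : 1 / ((n : ℝ) + 1) - 1 / ((n : ℝ) + 1 + 1) - 1 / ((n : ℝ) + 1 + 1) ^ 2 =
        1 / (((n : ℝ) + 1) * ((n : ℝ) + 1 + 1) ^ 2) := by field_simp; ring
    have : 0 ≤ 1 / (((n : ℝ) + 1) * ((n : ℝ) + 1 + 1) ^ 2) := by positivity
    push_cast
    linarith

lemma sum_gcWeight_le (s : Finset (ℕ × ℕ)) (hs : ∀ q ∈ s, isGC q.1 q.2) :
    ∑ q ∈ s, gcWeight q.1 ≤ 2 := by
  obtain ⟨N, hN⟩ : ∃ N, ∀ q ∈ s, q.1 - 1 < N + 1 := by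
    refine ⟨s.sup (fun q => q.1), fun q hq => ?_⟩
    have : q.1 ≤ s.sup (fun q => q.1) := Finset.le_sup (f := fun q : ℕ × ℕ => q.1) hq
    omega
  rw [← Finset.sum_fiberwise_of_maps_to (t := Finset.range (N + 1)) (g := fun q => q.1 - 1)
    (fun q hq => Finset.mem_range.2 (hN q hq))]
  refine (Finset.sum_le_sum (g := fun j : ℕ => 1 / ((j : ℝ) + 1) ^ 2) ?_).trans
    ((sum_one_div_sq_le N).trans (sub_le_self _ (by positivity)))
  intro j _
  have hfst : ∀ q ∈ s.filter (fun q => q.1 - 1 = j), q.1 = j + 1 := by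
    intro q hq
    rw [Finset.mem_filter] at hq
    have := (hs q hq.1).bounds
    omega
  have hcard : (s.filter (fun q => q.1 - 1 = j)).card ≤ Nat.log 2 (j + 1) + 1 := by
    rw [← Finset.card_image_of_injOn (f := Prod.snd)]
    · apply card_isGC_le
      intro B hB
      obtain ⟨q, hq, rfl⟩ := Finset.mem_image.1 hB
      rw [← hfst q hq]
      exact hs q (Finset.mem_filter.1 hq).1
    · intro a ha b hb hab
      exact Prod.ext ((hfst a ha).trans (hfst b hb).symm) hab
  rw [Finset.sum_congr rfl (fun q hq => by rw [hfst q hq]), Finset.sum_const, nsmul_eq_mul]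
  calc ((s.filter (fun q => q.1 - 1 = j)).card : ℝ) * gcWeight (j + 1)
      ≤ ((Nat.log 2 (j + 1) + 1 : ℕ) : ℝ) * gcWeight (j + 1) := by
        gcongr
        exact gcWeight_nonneg _
    _ = _ := by
        unfold gcWeight
        push_cast
        field_simp
        ring

lemma sum_subtype_gcWeight_le (u : Finset {q : ℕ × ℕ // isGC q.1 q.2}) :
    ∑ J ∈ u, gcWeight J.1.1 ≤ 2 := by
  have := sum_gcWeight_le (u.map (Function.Embedding.subtype _)) (by
    intro q hq
    obtain ⟨J, _, rfl⟩ := Finset.mem_map.1 hq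
    exact J.2)
  simpa using this

lemma summable_gcWeight : Summable fun J : {q : ℕ × ℕ // isGC q.1 q.2} => gcWeight J.1.1 :=
  summable_of_sum_le (fun _ => gcWeight_nonneg _) sum_subtype_gcWeight_le

lemma tsum_gcWeight_le : ∑' J : {q : ℕ × ℕ // isGC q.1 q.2}, gcWeight J.1.1 ≤ 2 :=
  Real.tsum_le_of_sum_le (fun _ => gcWeight_nonneg _) sum_subtype_gcWeight_le

lemma sum_gcWeight_le_tsum (s : Finset (ℕ × ℕ)) (hs : ∀ q ∈ s, isGC q.1 q.2) :
    ∑ q ∈ s, gcWeight q.1 ≤ ∑' J : {q : ℕ × ℕ // isGC q.1 q.2}, gcWeight J.1.1 := by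
  have := summable_gcWeight.sum_le_tsum (s.subtype fun q => isGC q.1 q.2)
    (fun _ _ => gcWeight_nonneg _)
  rwa [Finset.sum_subtype_of_mem (fun q : ℕ × ℕ => gcWeight q.1) hs] at this

lemma sum_Icc_indicator {M : Type*} [AddCommMonoid M] (F : ℕ → M) {A B m : ℕ} (hA : 1 ≤ A) :
    (∑ τ ∈ Finset.Icc 1 m, if A ≤ τ ∧ τ ≤ B then F τ else 0) =
      ∑ i ∈ Finset.range (min m B + 1 - A), F (A + i) := by
  rw [← Finset.sum_filter, ← Finset.sum_Ico_eq_sum_range]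
  apply Finset.sum_congr _ (fun _ _ => rfl)
  ext τ
  simp only [Finset.mem_filter, Finset.mem_Icc, Finset.mem_Ico]
  omega

/-- The numerical comparison behind the meta regret bound. -/
lemma le_sqrt_of_wealth_le {n A B : ℕ} {z : ℝ} (hn : 1 ≤ n) (hnA : n ≤ A) (hAB : A ≤ B)
    (h0 : 0 ≤ z) (hz : z ≤ n) (hW : ktPotential n z ≤ 2 * (gcWeight A)⁻¹) :
    z ≤ Real.sqrt (n * (7 * Real.log B + 5)) := by
  have hn0 : (1 : ℝ) ≤ n := by exact_mod_cast hn
  have hnB : (n : ℝ) ≤ B := by exact_mod_cast hnA.trans hAB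
  have hA0 : (1 : ℝ) ≤ A := by exact_mod_cast hn.trans hnA
  have hAB' : (A : ℝ) ≤ B := by exact_mod_cast hAB
  have hB0 : (1 : ℝ) ≤ B := hA0.trans hAB'
  have hlogA : 1 + (Nat.log 2 A : ℝ) ≤ A := by
    have : Nat.log 2 A < A := Nat.log_lt_self 2 (by omega)
    have : 1 + Nat.log 2 A ≤ A := by omega
    exact_mod_cast this
  have hweight : (gcWeight A)⁻¹ ≤ (B : ℝ) ^ 3 := by
    unfold gcWeight
    rw [one_div, inv_inv]
    calc (A : ℝ) ^ 2 * (1 + (Nat.log 2 A : ℝ)) ≤ (B : ℝ) ^ 2 * B := by gcongr; linarith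
      _ = _ := by ring
  have hexp : Real.exp (z ^ 2 / (2 * n)) ≤ Real.sqrt (5 * B) * (2 * (B : ℝ) ^ 3) := by
    refine (exp_le_ktPotential hn h0 hz).trans ?_
    apply mul_le_mul (Real.sqrt_le_sqrt (by linarith)) (hW.trans (by linarith))
      (ktPotential_pos _ _).le (Real.sqrt_nonneg _)
  have hlog := Real.log_le_log (Real.exp_pos _) hexp
  rw [Real.log_exp, Real.log_mul (by positivity) (by positivity),
    Real.log_sqrt (by positivity), Real.log_mul (by norm_num) (by positivity),
    Real.log_mul (by norm_num) (by positivity), Real.log_pow] at hlog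
  have h5 : Real.log 5 ≤ 2 := by
    rw [Real.log_le_iff_le_exp (by norm_num)]
    have := Real.exp_one_gt_d9
    have e : Real.exp 2 = Real.exp 1 ^ 2 := by rw [← Real.exp_nat_mul]; norm_num
    rw [e]; nlinarith
  have h2 := Real.log_two_lt_d9
  apply Real.le_sqrt_of_sq_le
  have e : z ^ 2 = n * (2 * (z ^ 2 / (2 * n))) := by field_simp
  rw [e]
  gcongr
  push_cast at hlog
  linarith

/-- **Meta regret of CBCE.** Assume each loss `f_t : 𝒟 → [0,1]` is convex. The CBCE
algorithm run with the prior `π̄_{B_J} = Z⁻¹·(J₁²(1+⌊log₂ J₁⌋))⁻¹` and the KT betting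
fraction with `δ = 0` satisfies, for every geometric covering interval `J = [J₁..J₂]`
with `J₂ ≤ T`: `∑_{t∈J} (f_t(x_t) − f_t(x_t^{B_J})) ≤ √(|J|·(7 ln J₂ + 5))`. -/
theorem cbce_meta_regret {V : Type*} [AddCommGroup V] [Module ℝ V]
    (D : Set V) (hD : Convex ℝ D) (T : ℕ) (hT : 1 ≤ T)
    (f : ℕ → V → ℝ)
    (hf01 : ∀ t ∈ Finset.Icc 1 T, ∀ y ∈ D, f t y ∈ Set.Icc (0 : ℝ) 1)
    (hfconv : ∀ t ∈ Finset.Icc 1 T, ConvexOn ℝ D (f t))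
    -- the black-box decisions
    (xB : ℕ × ℕ → ℕ → V) (hxB : ∀ q : ℕ × ℕ, ∀ t : ℕ, xB q t ∈ D)
    -- the prior over black-box runs
    (Z : ℝ)
    (hZ : Z = ∑' J : {q : ℕ × ℕ // isGC q.1 q.2},
      1 / ((J.1.1 : ℝ) ^ 2 * (1 + (Nat.log 2 J.1.1 : ℝ))))
    (prior : ℕ × ℕ → ℝ)
    (hprior : ∀ q : ℕ × ℕ,
      prior q = Z⁻¹ * (1 / ((q.1 : ℝ) ^ 2 * (1 + (Nat.log 2 q.1 : ℝ)))))
    -- the quantities maintained by CBCE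
    (S : ℕ → ℕ × ℕ → ℕ)
    (hS : ∀ t q, S t q =
      1 + ∑ τ ∈ Finset.Icc 1 (t - 1), if q.1 ≤ τ ∧ τ ≤ q.2 then 1 else 0)
    (w gt p : ℕ → ℕ × ℕ → ℝ) (x : ℕ → V)
    (hw : ∀ t ∈ Finset.Icc 1 T, ∀ q ∈ Active t, w t q =
      (∑ τ ∈ Finset.Icc 1 (t - 1), if q.1 ≤ τ ∧ τ ≤ q.2 then gt τ q else 0) /
          (S t q : ℝ) *
        (1 + ∑ τ ∈ Finset.Icc 1 (t - 1), if q.1 ≤ τ ∧ τ ≤ q.2 then gt τ q * w τ q else 0))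
    (hp : ∀ t ∈ Finset.Icc 1 T, ∀ q ∈ Active t, p t q =
      if 0 < ∑ r ∈ Active t, prior r * max (w t r) 0 then
        prior q * max (w t q) 0 / ∑ r ∈ Active t, prior r * max (w t r) 0
      else prior q / ∑ r ∈ Active t, prior r)
    (hx : ∀ t ∈ Finset.Icc 1 T, x t = ∑ q ∈ Active t, p t q • xB q t)
    (hgt : ∀ t ∈ Finset.Icc 1 T, ∀ q ∈ Active t, gt t q =
      if 0 < w t q then f t (x t) - f t (xB q t)
      else max (f t (x t) - f t (xB q t)) 0)
    -- the geometric covering interval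
    (J₁ J₂ : ℕ) (hJ : isGC J₁ J₂) (hJT : J₂ ≤ T) :
    ∑ t ∈ Finset.Icc J₁ J₂, (f t (x t) - f t (xB (J₁, J₂) t)) ≤
      Real.sqrt (((J₂ : ℝ) - J₁ + 1) * (7 * Real.log J₂ + 5)) := by
  have hZpos : 0 < Z := by
    have h := sum_gcWeight_le_tsum {(1, 1)} (by
      simpa only [Finset.mem_singleton, forall_eq] using (mem_Active.1 (self_mem_Active le_rfl)).1)
    rw [Finset.sum_singleton] at h
    rw [hZ]
    exact (gcWeight_pos le_rfl).trans_le h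
  have hZle : Z ≤ 2 := hZ ▸ tsum_gcWeight_le
  have hprior' : ∀ q, prior q = Z⁻¹ * gcWeight q.1 := hprior
  have hprior_pos : ∀ q : ℕ × ℕ, isGC q.1 q.2 → 0 < prior q := by
    intro q hq
    rw [hprior']
    exact mul_pos (inv_pos.2 hZpos) (gcWeight_pos hq.bounds.1)
  have hsum_pos : ∀ t ∈ Finset.Icc 1 T, 0 < ∑ r ∈ Active t, prior r := by
    intro t ht
    exact Finset.sum_pos (fun q hq => hprior_pos q (mem_Active.1 hq).1)
      ⟨_, self_mem_Active (Finset.mem_Icc.1 ht).1⟩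
  have hphat_nonneg : ∀ t, ∀ q ∈ Active t, 0 ≤ prior q * max (w t q) 0 := fun t q hq =>
    mul_nonneg (hprior_pos q (mem_Active.1 hq).1).le (le_max_right _ _)
  have hp_nonneg : ∀ t ∈ Finset.Icc 1 T, ∀ q ∈ Active t, 0 ≤ p t q := by
    intro t ht q hq
    rw [hp t ht q hq]
    split_ifs with h
    · exact div_nonneg (hphat_nonneg t q hq) h.le
    · exact div_nonneg (hprior_pos q (mem_Active.1 hq).1).le (hsum_pos t ht).le
  have hp_sum : ∀ t ∈ Finset.Icc 1 T, ∑ q ∈ Active t, p t q = 1 := by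
    intro t ht
    rw [Finset.sum_congr rfl (hp t ht)]
    split_ifs with h
    · rw [← Finset.sum_div, div_self h.ne']
    · rw [← Finset.sum_div, div_self (hsum_pos t ht).ne']
  have hxD : ∀ t ∈ Finset.Icc 1 T, x t ∈ D := by
    intro t ht
    rw [hx t ht]
    exact hD.sum_mem (hp_nonneg t ht) (hp_sum t ht) (fun q _ => hxB q t)
  have hjensen : ∀ t ∈ Finset.Icc 1 T, f t (x t) ≤ ∑ q ∈ Active t, p t q * f t (xB q t) := by
    intro t ht
    rw [hx t ht]
    exact (hfconv t ht).map_sum_le (hp_nonneg t ht) (hp_sum t ht) (fun q _ => hxB q t)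
  have hgt_abs : ∀ t ∈ Finset.Icc 1 T, ∀ q ∈ Active t, |gt t q| ≤ 1 := by
    intro t ht q hq
    have h1 := hf01 t ht _ (hxD t ht)
    have h2 := hf01 t ht _ (hxB q t)
    have h3 : f t (x t) - f t (xB q t) ≤ 1 := by linarith [h1.2, h2.1]
    rw [hgt t ht q hq, abs_le]
    split_ifs
    · exact ⟨by linarith [h1.1, h2.2], h3⟩
    · exact ⟨by linarith [le_max_right (f t (x t) - f t (xB q t)) 0], max_le h3 zero_le_one⟩
  have hgt_ge : ∀ t ∈ Finset.Icc 1 T, ∀ q ∈ Active t, f t (x t) - f t (xB q t) ≤ gt t q := by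
    intro t ht q hq
    rw [hgt t ht q hq]
    split_ifs
    · exact le_rfl
    · exact le_max_left _ _
  -- the prior-weighted aggregate bet never wins
  have hbet : ∀ t ∈ Finset.Icc 1 T, ∑ q ∈ Active t, prior q * (gt t q * w t q) ≤ 0 := by
    intro t ht
    have hterm : ∀ q ∈ Active t, prior q * (gt t q * w t q) ≤
        prior q * max (w t q) 0 * (f t (x t) - f t (xB q t)) := by
      intro q hq
      have hpos := (hprior_pos q (mem_Active.1 hq).1).le
      rw [hgt t ht q hq]
      split_ifs with h
      · rw [max_eq_left h.le]
        exact le_of_eq (by ring)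
      · rw [max_eq_right (not_lt.1 h), mul_zero, zero_mul]
        exact mul_nonpos_of_nonneg_of_nonpos hpos
          (mul_nonpos_of_nonneg_of_nonpos (le_max_right _ _) (not_lt.1 h))
    refine (Finset.sum_le_sum hterm).trans ?_
    by_cases h : 0 < ∑ r ∈ Active t, prior r * max (w t r) 0
    · have e : ∀ q ∈ Active t, prior q * max (w t q) 0 * (f t (x t) - f t (xB q t)) =
          (∑ r ∈ Active t, prior r * max (w t r) 0) *
            (p t q * f t (x t) - p t q * f t (xB q t)) := by
        intro q hq
        rw [hp t ht q hq, if_pos h]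
        field_simp
      rw [Finset.sum_congr rfl e, ← Finset.mul_sum, Finset.sum_sub_distrib, ← Finset.sum_mul,
        hp_sum t ht, one_mul]
      exact mul_nonpos_of_nonneg_of_nonpos h.le (sub_nonpos.2 (hjensen t ht))
    · have h0 : ∑ r ∈ Active t, prior r * max (w t r) 0 = 0 :=
        le_antisymm (not_lt.1 h) (Finset.sum_nonneg (hphat_nonneg t))
      have hz := (Finset.sum_eq_zero_iff_of_nonneg (hphat_nonneg t)).1 h0
      exact (Finset.sum_eq_zero (fun q hq => by rw [hz q hq, zero_mul])).le
  -- each black box is a Krichevsky–Trofimov bettor during its lifetime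
  have hkt : ∀ q : ℕ × ℕ, isGC q.1 q.2 →
      |∑ i ∈ Finset.range (min T q.2 + 1 - q.1), gt (q.1 + i) q| ≤
          ((min T q.2 + 1 - q.1 : ℕ) : ℝ) ∧
        ktPotential (min T q.2 + 1 - q.1)
            (∑ i ∈ Finset.range (min T q.2 + 1 - q.1), gt (q.1 + i) q) ≤
          1 + ∑ i ∈ Finset.range (min T q.2 + 1 - q.1), gt (q.1 + i) q * w (q.1 + i) q := by
    intro q hq
    have hb := hq.bounds
    have hmem : ∀ i < min T q.2 + 1 - q.1,
        q.1 + i ∈ Finset.Icc 1 T ∧ q ∈ Active (q.1 + i) := by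
      intro i hi
      exact ⟨Finset.mem_Icc.2 (by omega), mem_Active.2 ⟨hq, by omega, by omega⟩⟩
    refine ktPotential_le_wealth (g := fun i => gt (q.1 + i) q) (w := fun i => w (q.1 + i) q)
      (fun i hi => hgt_abs _ (hmem i hi).1 q (hmem i hi).2) (fun i hi => ?_)
    have hrange : min (q.1 + i - 1) q.2 + 1 - q.1 = i := by omega
    rw [hw _ (hmem i hi).1 q (hmem i hi).2, hS, sum_Icc_indicator (fun τ => gt τ q) hb.1,
      sum_Icc_indicator (fun τ => gt τ q * w τ q) hb.1,
      sum_Icc_indicator (fun _ => 1) hb.1, hrange]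
    simp [add_comm]
  -- the total wealth is at most the initial one
  set F : Finset (ℕ × ℕ) :=
    (Finset.Icc 1 T ×ˢ Finset.Icc 1 (2 * T)).filter fun q => isGC q.1 q.2 with hF
  have hFgc : ∀ q ∈ F, isGC q.1 q.2 := fun q hq => (Finset.mem_filter.1 hq).2
  set wealth : ℕ × ℕ → ℝ := fun q =>
    1 + ∑ i ∈ Finset.range (min T q.2 + 1 - q.1), gt (q.1 + i) q * w (q.1 + i) q with hwealth
  have hwealth_pos : ∀ q ∈ F, 0 < wealth q := fun q hq =>
    (ktPotential_pos _ _).trans_le (hkt q (hFgc q hq)).2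
  have htotal : ∑ q ∈ F, prior q * wealth q ≤ 1 := by
    have hpr : ∑ q ∈ F, prior q ≤ 1 := by
      rw [Finset.sum_congr rfl (fun q _ => hprior' q), ← Finset.mul_sum, inv_mul_le_iff₀ hZpos,
        mul_one, hZ]
      exact sum_gcWeight_le_tsum F hFgc
    have e : ∀ q ∈ F, prior q * wealth q = prior q +
        ∑ τ ∈ Finset.Icc 1 T, if q.1 ≤ τ ∧ τ ≤ q.2 then prior q * (gt τ q * w τ q) else 0 := by
      intro q hq
      rw [sum_Icc_indicator (fun τ => prior q * (gt τ q * w τ q)) (hFgc q hq).bounds.1,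
        ← Finset.mul_sum]
      simp only [hwealth]
      ring
    rw [Finset.sum_congr rfl e, Finset.sum_add_distrib, Finset.sum_comm]
    have hle : ∑ τ ∈ Finset.Icc 1 T, ∑ q ∈ F,
        (if q.1 ≤ τ ∧ τ ≤ q.2 then prior q * (gt τ q * w τ q) else 0) ≤ 0 := by
      refine Finset.sum_nonpos fun τ hτ => ?_
      refine le_trans (le_of_eq ?_) (hbet τ hτ)
      rw [← Finset.sum_filter]
      refine Finset.sum_congr ?_ (fun _ _ => rfl)
      ext q
      rw [mem_Active, hF]
      simp only [Finset.mem_filter, Finset.mem_product, Finset.mem_Icc] at hτ ⊢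
      refine ⟨fun h => ⟨h.1.2, h.2⟩, fun h => ⟨⟨?_, h.1⟩, h.2⟩⟩
      have := h.1.bounds
      omega
    linarith
  -- conclusion for the interval `[J₁..J₂]`
  have hb := hJ.bounds
  have hmin : min T J₂ = J₂ := min_eq_right hJT
  have hJF : (J₁, J₂) ∈ F := by
    rw [hF]
    simp only [Finset.mem_filter, Finset.mem_product, Finset.mem_Icc]
    exact ⟨by omega, hJ⟩
  have hJwealth : wealth (J₁, J₂) ≤ 2 * (gcWeight J₁)⁻¹ := by
    have h1 : prior (J₁, J₂) * wealth (J₁, J₂) ≤ 1 :=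
      (Finset.single_le_sum (f := fun q => prior q * wealth q) (fun q hq =>
        mul_nonneg (hprior_pos q (hFgc q hq)).le (hwealth_pos q hq).le) hJF).trans htotal
    have hg := gcWeight_pos hb.1
    rw [hprior', mul_assoc, inv_mul_le_iff₀ hZpos, mul_one] at h1
    rw [← div_eq_mul_inv, le_div_iff₀ hg]
    linarith
  obtain ⟨hzabs, hpot⟩ := hkt (J₁, J₂) hJ
  have hpot' := hpot.trans hJwealth
  simp only [hmin] at hzabs hpot'
  have hreg : ∑ t ∈ Finset.Icc J₁ J₂, (f t (x t) - f t (xB (J₁, J₂) t)) ≤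
      ∑ i ∈ Finset.range (J₂ + 1 - J₁), gt (J₁ + i) (J₁, J₂) := by
    rw [← Finset.sum_Ico_eq_sum_range (fun t => gt t (J₁, J₂))]
    have hI : Finset.Icc J₁ J₂ = Finset.Ico J₁ (J₂ + 1) := by
      ext t
      simp only [Finset.mem_Icc, Finset.mem_Ico]
      omega
    rw [← hI]
    refine Finset.sum_le_sum fun t ht => ?_
    rw [Finset.mem_Icc] at ht
    exact hgt_ge t (Finset.mem_Icc.2 (by omega)) _ (mem_Active.2 ⟨hJ, ht.1, ht.2⟩)
  rcases lt_or_ge (∑ i ∈ Finset.range (J₂ + 1 - J₁), gt (J₁ + i) (J₁, J₂)) 0 with hneg | hnn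
  · exact (hreg.trans hneg.le).trans (Real.sqrt_nonneg _)
  · have hlen : ((J₂ + 1 - J₁ : ℕ) : ℝ) = (J₂ : ℝ) - J₁ + 1 := by
      rw [Nat.cast_sub (by omega)]
      push_cast
      ring
    rw [← hlen]
    exact hreg.trans (le_sqrt_of_wealth_le (A := J₁) (by omega) (by omega) hb.2.1 hnn
      ((le_abs_self _).trans hzabs) hpot')
end

section
/- (Strongly adaptive regret implies m-shift regret) Let T be a positive integer, 𝒲 a set, f_t : 𝒲 → ℝ arbitrary loss functions and x_t ∈ 𝒲 arbitrary decisions for t = 1, …, T, and c > 0. Suppose that for every interval [I₁..I₂] ⊆ [1..T] and every w ∈ 𝒲, ∑_{t=I₁}^{I₂} ( f_t(x_t) − f_t(w) ) ≤ c·sqrt( (I₂ − I₁ + 1)·ln(I₂) ). Then for every m ≥ 0 and every m-shift comparator sequence (w_1, …, w_T) ∈ 𝒲^T, ∑_{t=1}^{T} ( f_t(x_t) − f_t(w_t) ) ≤ c·sqrt( (m+1)·T·ln(T) ). -/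
/-- The Cauchy–Schwarz inequality `√(k a L) + √(b L) ≤ √((k + 1) (a + b) L)`. -/
theorem sqrt_mul_add_sqrt_le {k a b L : ℝ} (hk : 0 ≤ k) (ha : 0 ≤ a) (hb : 0 ≤ b) (hL : 0 ≤ L) :
    √(k * a * L) + √(b * L) ≤ √((k + 1) * (a + b) * L) := by
  apply Real.le_sqrt_of_sq_le
  have h1 : √(k * a * L) = √k * √a * √L := by
    rw [Real.sqrt_mul (by positivity), Real.sqrt_mul hk]
  rw [h1, Real.sqrt_mul hb]
  have ek := Real.sq_sqrt hk
  have ea := Real.sq_sqrt ha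
  have eb := Real.sq_sqrt hb
  have eL := Real.sq_sqrt hL
  generalize √k = p at *
  generalize √a = q at *
  generalize √b = r at *
  generalize √L = l at *
  subst ek ea eb eL
  nlinarith [sq_nonneg ((p * r - q) * l)]

/-- A sequence without shifts in `[a, b)` is constant on `[a, b]`. -/
theorem eq_right_of_forall_eq_succ {W : Type*} {w : ℕ → W} {a b : ℕ}
    (h : ∀ t, a ≤ t → t < b → w t = w (t + 1)) {t : ℕ} (hat : a ≤ t) (htb : t ≤ b) :
    w t = w b := by
  induction b, htb using Nat.le_induction with
  | base => rfl
  | succ n hn ih =>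
    rw [ih fun s h1 h2 => h s h1 (by omega), h n (by omega) (by omega)]

/-- If `g` has interval sums at most `c √(length · L)` against fixed comparators, then its sum
along a sequence with at most `m` shifts is at most `c √((m + 1) · length · L)`. -/
theorem sum_le_of_card_shifts_le {W : Type*} {T : ℕ} {g : ℕ → W → ℝ} {c L : ℝ} (hc : 0 ≤ c)
    (hL : 0 ≤ L)
    (hg : ∀ a b : ℕ, 1 ≤ a → a ≤ b → b ≤ T → ∀ w : W,
      ∑ t ∈ Finset.Icc a b, g t w ≤ c * √(((b : ℝ) - a + 1) * L))
    (w : ℕ → W) [DecidablePred fun t => w t ≠ w (t + 1)] (N : ℕ) (hN : 1 ≤ N) (hNT : N ≤ T) (m : ℕ)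
    (hm : ((Finset.Ico 1 N).filter fun t => w t ≠ w (t + 1)).card ≤ m) :
    ∑ t ∈ Finset.Icc 1 N, g t (w t) ≤ c * √(((m : ℝ) + 1) * N * L) := by
  induction N using Nat.strong_induction_on generalizing m with
  | _ N ih =>
  set S := (Finset.Ico 1 N).filter fun t => w t ≠ w (t + 1) with hS
  have constant (a : ℕ) (ha : 1 ≤ a) (haN : a ≤ N)
      (h : ∀ t, a ≤ t → t < N → w t = w (t + 1)) :
      ∑ t ∈ Finset.Icc a N, g t (w t) ≤ c * √(((N : ℝ) - a + 1) * L) := by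
    refine le_trans (le_of_eq (Finset.sum_congr rfl fun t ht => ?_)) (hg a N ha haN hNT (w N))
    rw [Finset.mem_Icc] at ht
    rw [eq_right_of_forall_eq_succ h ht.1 ht.2]
  rcases S.eq_empty_or_nonempty with hE | hne
  · refine (constant 1 le_rfl hN fun t h1 h2 => ?_).trans ?_
    · by_contra hw
      have : t ∈ S := by simp [hS, h1, h2, hw]
      simp [hE] at this
    · gcongr
      have : (0 : ℝ) ≤ m * N := by positivity
      push_cast
      linarith
  · obtain ⟨s, hs, hmax⟩ := S.exists_max_image id hne
    obtain ⟨⟨hs1, hsN⟩, -⟩ : (1 ≤ s ∧ s < N) ∧ w s ≠ w (s + 1) := by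
      simpa [hS] using hs
    obtain ⟨k, rfl⟩ : ∃ k, m = k + 1 := Nat.exists_eq_succ_of_ne_zero
      (by have := hne.card_pos; omega)
    have hcard : ((Finset.Ico 1 s).filter fun t => w t ≠ w (t + 1)).card ≤ k := by
      have hlt : ((Finset.Ico 1 s).filter fun t => w t ≠ w (t + 1)).card < S.card := by
        refine Finset.card_lt_card (Finset.ssubset_iff_subset_ne.2 ⟨?_, fun h => ?_⟩)
        · exact Finset.filter_subset_filter _ (Finset.Ico_subset_Ico_right hsN.le)
        · rw [← h] at hs
          simp at hs
      omega
    have hfst := ih s hsN hs1 (by omega) k hcard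
    have hsnd := constant (s + 1) (by omega) hsN fun t h1 h2 => by
      by_contra hw
      have := hmax t (by simp [hS, h2, hw]; omega)
      simp only [id] at this
      omega
    have hsplit : ∑ t ∈ Finset.Icc 1 N, g t (w t) =
        ∑ t ∈ Finset.Icc 1 s, g t (w t) + ∑ t ∈ Finset.Icc (s + 1) N, g t (w t) := by
      have e (a b : ℕ) : Finset.Icc (a + 1) b = Finset.Ioc a b := by
        ext; simp
      rw [← zero_add 1, e, e, zero_add, e, Finset.sum_Ioc_consecutive _ (Nat.zero_le s) hsN.le]
    have hsN' : (0 : ℝ) ≤ (N : ℝ) - s := sub_nonneg.2 (by exact_mod_cast hsN.le)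
    have hcs := mul_le_mul_of_nonneg_left
      (sqrt_mul_add_sqrt_le (k := (k : ℝ) + 1) (a := s) (by positivity) (by positivity) hsN' hL) hc
    rw [show (N : ℝ) - ((s + 1 : ℕ) : ℝ) + 1 = N - s by push_cast; ring] at hsnd
    rw [add_sub_cancel, mul_add] at hcs
    push_cast
    linarith

/-- Strongly adaptive regret implies `m`-shift regret: if on every interval
`[I₁..I₂] ⊆ [1..T]` the regret against any fixed comparator is at most
`c·√((I₂−I₁+1)·ln I₂)`, then against any comparator sequence with at most `m`
shifts the regret is at most `c·√((m+1)·T·ln T)`. -/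
theorem sa_regret_implies_m_shift_regret {W : Type*} (T : ℕ) (hT : 0 < T)
    (f : ℕ → W → ℝ) (x : ℕ → W) (c : ℝ) (hc : 0 < c)
    (hSA : ∀ I₁ I₂ : ℕ, 1 ≤ I₁ → I₁ ≤ I₂ → I₂ ≤ T → ∀ w : W,
      ∑ t ∈ Finset.Icc I₁ I₂, (f t (x t) - f t w) ≤
        c * Real.sqrt (((I₂ : ℝ) - I₁ + 1) * Real.log I₂))
    (m : ℕ) (w : ℕ → W)
    (hshift : Set.ncard {t : ℕ | t ∈ Finset.Icc 1 (T - 1) ∧ w t ≠ w (t + 1)} ≤ m) :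
    ∑ t ∈ Finset.Icc 1 T, (f t (x t) - f t (w t)) ≤
      c * Real.sqrt (((m : ℝ) + 1) * T * Real.log T) := by
  classical
  refine sum_le_of_card_shifts_le (g := fun t v => f t (x t) - f t v) hc.le
    (Real.log_natCast_nonneg T) (fun a b ha hab hb v => (hSA a b ha hab hb v).trans ?_)
    w T hT le_rfl m ?_
  · have hab' : (0 : ℝ) ≤ (b : ℝ) - a + 1 := by
      have : (a : ℝ) ≤ b := by exact_mod_cast hab
      linarith
    have hb0 : (0 : ℝ) < b := by exact_mod_cast (by omega : 0 < b)
    gcongr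
  · rw [← Set.ncard_coe_finset]
    convert hshift using 3
    ext t
    simp only [Finset.coe_filter, Finset.mem_Ico, Finset.mem_Icc, Set.mem_ofPred_eq]
    exact and_congr_left fun _ => by omega
end

section
/- (Partition by data streaming intervals) Let g ≥ 1 be an integer and let 𝒥^DS be the data streaming intervals. Any interval [I₁..I₂] of positive integers can be partitioned into a sequence of disjoint and consecutive intervals J̄^(1), J̄^(2), …, J̄^(n) such that each J̄^(i) is a prefix of some interval J ∈ 𝒥^DS (i.e., J̄^(i) and J have the same first element and J̄^(i) ⊆ J), and the lengths satisfy |J̄^(i+1)| ≥ 2·|J̄^(i)| for every i = 1, …, n−2 (the lengths at least double from each interval to the next, except possibly at the final, truncated interval). -/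
/-- The left endpoints obtained from `a` by repeatedly appending an interval of length
`k * 2 ^ u`, where `u` is the 2-adic valuation of the current endpoint. -/
def streamEndpoint (k a : ℕ) : ℕ → ℕ
  | 0 => a
  | i + 1 => streamEndpoint k a i + k * 2 ^ padicValNat 2 (streamEndpoint k a i)

lemma padicValNat_lt_add_odd_mul {k t : ℕ} (hk : Odd k) (ht : t ≠ 0) :
    padicValNat 2 t < padicValNat 2 (t + k * 2 ^ padicValNat 2 t) := by
  have : Fact (Nat.Prime 2) := ⟨Nat.prime_two⟩
  rw [← Nat.succ_le_iff, ← padicValNat_dvd_iff_le (by omega)]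
  obtain ⟨m, hm⟩ : 2 ^ padicValNat 2 t ∣ t := pow_padicValNat_dvd
  have hodd : Odd m := by
    rw [← Nat.not_even_iff_odd, even_iff_two_dvd]
    rintro ⟨c, rfl⟩
    refine pow_succ_padicValNat_not_dvd (p := 2) ht ⟨c, ?_⟩
    rw [pow_succ, mul_assoc]
    exact hm
  obtain ⟨c, hc⟩ := hodd.add_odd hk
  refine ⟨c, ?_⟩
  calc t + k * 2 ^ padicValNat 2 t
      = 2 ^ padicValNat 2 t * m + k * 2 ^ padicValNat 2 t := by rw [← hm]
    _ = 2 ^ padicValNat 2 t * (m + k) := by ring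
    _ = 2 ^ (padicValNat 2 t).succ * c := by rw [hc, pow_succ]; ring

lemma streamEndpoint_strictMono {k : ℕ} (hk : 0 < k) (a : ℕ) :
    StrictMono (streamEndpoint k a) :=
  strictMono_nat_of_lt_succ fun i => by
    have : 0 < k * 2 ^ padicValNat 2 (streamEndpoint k a i) := by positivity
    simp only [streamEndpoint]
    omega

lemma two_mul_streamEndpoint_gap_le {k a : ℕ} (hk : Odd k) (ha : 1 ≤ a) (i : ℕ) :
    2 * (streamEndpoint k a (i + 1) - streamEndpoint k a i) ≤
      streamEndpoint k a (i + 2) - streamEndpoint k a (i + 1) := by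
  have hpos : streamEndpoint k a i ≠ 0 := by
    have : a ≤ streamEndpoint k a i := (streamEndpoint_strictMono hk.pos a).monotone i.zero_le
    omega
  have hlt := padicValNat_lt_add_odd_mul hk hpos
  have hgap (j : ℕ) : streamEndpoint k a (j + 1) - streamEndpoint k a j =
      k * 2 ^ padicValNat 2 (streamEndpoint k a j) := by
    simp [streamEndpoint]
  rw [hgap i, hgap (i + 1)]
  calc 2 * (k * 2 ^ padicValNat 2 (streamEndpoint k a i))
      = k * 2 ^ (padicValNat 2 (streamEndpoint k a i) + 1) := by ring
    _ ≤ k * 2 ^ padicValNat 2 (streamEndpoint k a (i + 1)) :=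
      Nat.mul_le_mul_left k (Nat.pow_le_pow_right two_pos hlt)

/-- Any interval `[I₁..I₂]` of positive integers can be partitioned into a sequence of
disjoint consecutive intervals `J̄^(1), …, J̄^(n)`, each a prefix of some data streaming
interval `[t .. t + g·2^{u(t)} − 1]` (where `u(t)` is the 2-adic valuation of `t`),
such that the lengths at least double from each interval to the next, except possibly
at the final, truncated interval. -/
theorem data_streaming_partition (g : ℕ) (hg : 1 ≤ g) (I₁ I₂ : ℕ)
    (h1 : 1 ≤ I₁) (h12 : I₁ ≤ I₂) :
    ∃ (n : ℕ) (st en : ℕ → ℕ), 1 ≤ n ∧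
      st 1 = I₁ ∧ en n = I₂ ∧
      (∀ i, 1 ≤ i → i < n → st (i + 1) = en i + 1) ∧
      (∀ i, 1 ≤ i → i ≤ n →
        st i ≤ en i ∧ en i ≤ st i + g * 2 ^ (padicValNat 2 (st i)) - 1) ∧
      (∀ i, 1 ≤ i → i ≤ n - 2 →
        2 * (en i - st i + 1) ≤ en (i + 1) - st (i + 1) + 1) := by
  set s := streamEndpoint 1 I₁
  have hmono : StrictMono s := streamEndpoint_strictMono one_pos I₁
  have hs0 : s 0 = I₁ := rfl
  have hex : ∃ n, I₂ < s n := ⟨I₂ + 1, hmono.le_apply⟩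
  obtain ⟨n, hn, hmin⟩ : ∃ n, I₂ < s n ∧ ∀ i < n, s i ≤ I₂ :=
    ⟨Nat.find hex, Nat.find_spec hex, fun i hi => not_lt.mp (Nat.find_min hex hi)⟩
  have hn1 : 1 ≤ n := by
    by_contra h
    obtain rfl : n = 0 := by omega
    omega
  refine ⟨n, fun i => s (i - 1), fun i => min (s i - 1) I₂, hn1, hs0, ?_, ?_, ?_, ?_⟩
  · exact min_eq_right (by omega)
  · intro i hi hin
    have := hmin i hin
    have := hmono (show i - 1 < i by omega)
    simp only [Nat.add_sub_cancel]
    omega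
  · intro i hi hin
    obtain ⟨j, rfl⟩ := Nat.exists_eq_add_of_le' hi
    have := hmin j (by omega)
    have := hmono (Nat.lt_succ_self j)
    have hstep : s (j + 1) = s j + 1 * 2 ^ padicValNat 2 (s j) := rfl
    have : 1 * 2 ^ padicValNat 2 (s j) ≤ g * 2 ^ padicValNat 2 (s j) :=
      Nat.mul_le_mul_right _ hg
    simp only [Nat.add_sub_cancel, Nat.succ_eq_add_one] at *
    omega
  · intro i hi hin
    obtain ⟨j, rfl⟩ := Nat.exists_eq_add_of_le' hi
    have := hmin (j + 1 + 1) (by omega)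
    have := hmono (show j < j + 1 by omega)
    have := hmono (show j + 1 < j + 1 + 1 by omega)
    have : 2 * (s (j + 1) - s j) ≤ s (j + 1 + 1) - s (j + 1) :=
      two_mul_streamEndpoint_gap_le odd_one h1 j
    simp only [Nat.add_sub_cancel]
    omega
end

section
/- (Nonpositivity of the weighted coin-flip sum) Let N be a positive integer, π ∈ Δ^N a probability vector, ℐ ∈ {0,1}^N with ∑_i π_i ℐ_i > 0, w ∈ ℝ^N, and ℓ ∈ [0,1]^N. Define p̂_i := π_i ℐ_i·max(w_i, 0); let p := p̂/‖p̂‖₁ if ‖p̂‖₁ > 0 and otherwise p_i := π_i ℐ_i/(∑_j π_j ℐ_j); let h := ∑_{i=1}^N p_i ℓ_i; and let g_i := h − ℓ_i if w_i > 0 and g_i := max(h − ℓ_i, 0) if w_i ≤ 0. Then ∑_{i=1}^N π_i ℐ_i g_i w_i ≤ 0. -/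
/-- Nonpositivity of the weighted coin-flip sum in the Sleeping CB algorithm:
with `p̂_i = π_i ℐ_i max(w_i,0)`, prediction `p`, loss `h = ∑ p_i ℓ_i`, and signed
coin flips `g_i`, we have `∑ π_i ℐ_i g_i w_i ≤ 0`. -/
theorem weighted_coin_flip_sum_nonpos (N : ℕ) (hN : 0 < N)
    (π : Fin N → ℝ) (hπ0 : ∀ i, 0 ≤ π i) (hπ1 : ∑ i, π i = 1)
    (ℐ : Fin N → ℕ) (hI : ∀ i, ℐ i ≤ 1)
    (hIpos : 0 < ∑ i, π i * (ℐ i : ℝ))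
    (w ℓ : Fin N → ℝ) (hℓ : ∀ i, ℓ i ∈ Set.Icc (0 : ℝ) 1)
    (p : Fin N → ℝ)
    (hp : ∀ i, p i =
      if 0 < ∑ j, π j * (ℐ j : ℝ) * max (w j) 0 then
        π i * (ℐ i : ℝ) * max (w i) 0 / ∑ j, π j * (ℐ j : ℝ) * max (w j) 0
      else π i * (ℐ i : ℝ) / ∑ j, π j * (ℐ j : ℝ))
    (h : ℝ) (hh : h = ∑ i, p i * ℓ i)
    (g : Fin N → ℝ)
    (hg : ∀ i, g i = if 0 < w i then h - ℓ i else max (h - ℓ i) 0) :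
    ∑ i, π i * (ℐ i : ℝ) * g i * w i ≤ 0 := by
  have hq : ∀ i, 0 ≤ π i * (ℐ i : ℝ) * max (w i) 0 := fun i =>
    mul_nonneg (mul_nonneg (hπ0 i) (Nat.cast_nonneg _)) (le_max_right _ _)
  have hterm : ∀ i, π i * (ℐ i : ℝ) * g i * w i ≤
      π i * (ℐ i : ℝ) * max (w i) 0 * (h - ℓ i) := by
    intro i
    rw [hg i]
    split_ifs with hw
    · rw [max_eq_left hw.le]
      exact le_of_eq (by ring)
    · rw [max_eq_right (not_lt.mp hw), mul_zero, zero_mul]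
      exact mul_nonpos_of_nonneg_of_nonpos
        (mul_nonneg (mul_nonneg (hπ0 i) (Nat.cast_nonneg _)) (le_max_right _ _))
        (not_lt.mp hw)
  refine (Finset.sum_le_sum fun i _ => hterm i).trans (le_of_eq ?_)
  by_cases hS : 0 < ∑ j, π j * (ℐ j : ℝ) * max (w j) 0
  · have hmean : (∑ j, π j * (ℐ j : ℝ) * max (w j) 0) * h =
        ∑ i, π i * (ℐ i : ℝ) * max (w i) 0 * ℓ i := by
      rw [hh, Finset.mul_sum]
      refine Finset.sum_congr rfl fun i _ => ?_
      rw [hp i, if_pos hS, ← mul_assoc, mul_div_cancel₀ _ hS.ne']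
    simp_rw [mul_sub]
    rw [Finset.sum_sub_distrib, ← Finset.sum_mul, hmean, sub_self]
  · have hS0 := le_antisymm (not_lt.mp hS) (Finset.sum_nonneg fun i _ => hq i)
    refine Finset.sum_eq_zero fun i hi => ?_
    rw [(Finset.sum_eq_zero_iff_of_nonneg fun i _ => hq i).mp hS0 i hi, zero_mul]
end

section
/- (Total wealth bound for Sleeping CB) Let (F_t)_{t≥1} be a sequence of even, strictly positive potential functions satisfying the wealth lower bound. Then the quantities produced by the Sleeping CB algorithm satisfy ∑_{i=1}^N π_i · F_{S_{T,i}}( ∑_{t=1}^T ℐ_{t,i} g̃_{t,i} ) ≤ 1. -/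
/-- `BettingReachable B s z r`: some betting sequence of length `s` with outcomes in `[-1, 1]` and
bets chosen by the rule `B` (a function of the round, the sum of the past outcomes and the past
reward) has outcome sum `z` and reward `r`. -/
def BettingReachable (B : ℕ → ℝ → ℝ → ℝ) (s : ℕ) (z r : ℝ) : Prop :=
  ∃ g v : ℕ → ℝ, (∀ τ ∈ Finset.Icc 1 s, |g τ| ≤ 1) ∧
    (∀ τ ∈ Finset.Icc 1 s, v τ =
      B τ (∑ σ ∈ Finset.Icc 1 (τ - 1), g σ) (∑ σ ∈ Finset.Icc 1 (τ - 1), g σ * v σ)) ∧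
    ∑ τ ∈ Finset.Icc 1 s, g τ = z ∧ ∑ τ ∈ Finset.Icc 1 s, g τ * v τ = r

theorem BettingReachable.zero (B : ℕ → ℝ → ℝ → ℝ) : BettingReachable B 0 0 0 :=
  ⟨0, 0, by simp, by simp, by simp, by simp⟩

theorem BettingReachable.succ {B : ℕ → ℝ → ℝ → ℝ} {s : ℕ} {z r : ℝ}
    (hs : BettingReachable B s z r) {x : ℝ} (hx : |x| ≤ 1) :
    BettingReachable B (s + 1) (z + x) (r + x * B (s + 1) z r) := by
  obtain ⟨g, v, hg, hv, rfl, rfl⟩ := hs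
  set y := B (s + 1) (∑ τ ∈ Finset.Icc 1 s, g τ) (∑ τ ∈ Finset.Icc 1 s, g τ * v τ) with hy
  let g' := Function.update g (s + 1) x
  let v' := Function.update v (s + 1) y
  have hg' : ∀ σ ≤ s, g' σ = g σ := fun σ hσ => Function.update_of_ne (by omega) _ _
  have hv' : ∀ σ ≤ s, v' σ = v σ := fun σ hσ => Function.update_of_ne (by omega) _ _
  have hgs : g' (s + 1) = x := Function.update_self _ _ _
  have hvs : v' (s + 1) = y := Function.update_self _ _ _
  have sum_g : ∀ k ≤ s, ∑ σ ∈ Finset.Icc 1 k, g' σ = ∑ σ ∈ Finset.Icc 1 k, g σ :=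
    fun k hk => Finset.sum_congr rfl fun σ hσ => hg' σ ((Finset.mem_Icc.1 hσ).2.trans hk)
  have sum_gv : ∀ k ≤ s, ∑ σ ∈ Finset.Icc 1 k, g' σ * v' σ = ∑ σ ∈ Finset.Icc 1 k, g σ * v σ :=
    fun k hk => Finset.sum_congr rfl fun σ hσ => by
      have hσs := (Finset.mem_Icc.1 hσ).2.trans hk
      rw [hg' σ hσs, hv' σ hσs]
  refine ⟨g', v', fun τ hτ => ?_, fun τ hτ => ?_, ?_, ?_⟩
  · obtain ⟨h1, h2⟩ := Finset.mem_Icc.1 hτ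
    rcases Nat.le_succ_iff.1 h2 with h2 | rfl
    · rw [hg' τ h2]
      exact hg τ (Finset.mem_Icc.2 ⟨h1, h2⟩)
    · rwa [hgs]
  · obtain ⟨h1, h2⟩ := Finset.mem_Icc.1 hτ
    rw [sum_g _ (by omega), sum_gv _ (by omega)]
    rcases Nat.le_succ_iff.1 h2 with h2 | rfl
    · rw [hv' τ h2]
      exact hv τ (Finset.mem_Icc.2 ⟨h1, h2⟩)
    · exact hvs
  · rw [Finset.sum_Icc_succ_top (by omega), sum_g s le_rfl, hgs]
  · rw [Finset.sum_Icc_succ_top (by omega), sum_gv s le_rfl, hgs, hvs]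

/-- Dropping the rounds in which an expert is asleep turns its sequence of outcomes and bets
into a betting sequence. -/
theorem BettingReachable.of_awake (B : ℕ → ℝ → ℝ → ℝ) (a : ℕ → ℕ) (ha : ∀ t, a t ≤ 1)
    (g w : ℕ → ℝ) (n : ℕ) (hg : ∀ t ∈ Finset.Icc 1 n, |(a t : ℝ) * g t| ≤ 1)
    (hw : ∀ t ∈ Finset.Icc 1 n, w t = B (1 + ∑ τ ∈ Finset.Icc 1 (t - 1), a τ)
      (∑ τ ∈ Finset.Icc 1 (t - 1), (a τ : ℝ) * g τ)
      (∑ τ ∈ Finset.Icc 1 (t - 1), (a τ : ℝ) * g τ * w τ)) :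
    BettingReachable B (∑ t ∈ Finset.Icc 1 n, a t) (∑ t ∈ Finset.Icc 1 n, (a t : ℝ) * g t)
      (∑ t ∈ Finset.Icc 1 n, (a t : ℝ) * g t * w t) := by
  induction n with
  | zero => simpa using BettingReachable.zero B
  | succ n ih =>
    have hsub : Finset.Icc 1 n ⊆ Finset.Icc 1 (n + 1) := Finset.Icc_subset_Icc_right n.le_succ
    have ih := ih (fun t ht => hg t (hsub ht)) fun t ht => hw t (hsub ht)
    have hmem : n + 1 ∈ Finset.Icc 1 (n + 1) := by simp
    have hwn := hw _ hmem
    have hgn := hg _ hmem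
    rw [Nat.add_sub_cancel, add_comm 1] at hwn
    simp only [Finset.sum_Icc_succ_top (Nat.le_add_left 1 n)]
    rcases Nat.le_one_iff_eq_zero_or_eq_one.1 (ha (n + 1)) with h0 | h1
    · simpa [h0] using ih
    · have hsucc := ih.succ hgn
      rw [← hwn] at hsucc
      rwa [h1] at hsucc ⊢

/-- Normalized nonnegative weights average `[0, 1]`-valued losses to a value in `[0, 1]`. -/
theorem sum_div_sum_mul_mem_Icc {ι : Type*} [Fintype ι] (q l : ι → ℝ) (hq : ∀ i, 0 ≤ q i)
    (hl : ∀ i, l i ∈ Set.Icc (0 : ℝ) 1) : ∑ i, q i / (∑ j, q j) * l i ∈ Set.Icc (0 : ℝ) 1 := by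
  have hQ : 0 ≤ ∑ j, q j := Finset.sum_nonneg fun j _ => hq j
  have hnn : ∀ i, 0 ≤ q i / ∑ j, q j := fun i => div_nonneg (hq i) hQ
  refine ⟨Finset.sum_nonneg fun i _ => mul_nonneg (hnn i) (hl i).1, ?_⟩
  calc ∑ i, q i / (∑ j, q j) * l i ≤ ∑ i, q i / ∑ j, q j :=
        Finset.sum_le_sum fun i _ => mul_le_of_le_one_right (hnn i) (hl i).2
    _ = (∑ i, q i) / ∑ j, q j := (Finset.sum_div _ _ _).symm
    _ ≤ 1 := div_self_le_one _

/-- If the aggregate loss `h` is the average of `l` under the normalized weights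
`c i * max (x i) 0`, then truncating `h - l i` from below when `x i ≤ 0` makes the total
reward nonpositive. -/
theorem sum_mul_truncated_regret_mul_nonpos {ι : Type*} [Fintype ι] (c x l g : ι → ℝ) (h : ℝ)
    (hc : ∀ i, 0 ≤ c i)
    (hh : 0 < ∑ j, c j * max (x j) 0 →
      h = ∑ i, c i * max (x i) 0 / (∑ j, c j * max (x j) 0) * l i)
    (hg : ∀ i, c i ≠ 0 → g i = if 0 < x i then h - l i else max (h - l i) 0) :
    ∑ i, c i * g i * x i ≤ 0 := by
  have hnn : ∀ i, 0 ≤ c i * max (x i) 0 := fun i => mul_nonneg (hc i) (le_max_right _ _)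
  have hle : ∀ i, c i * g i * x i ≤ c i * max (x i) 0 * (h - l i) := fun i => by
    rcases eq_or_ne (c i) 0 with h0 | h0
    · simp [h0]
    rw [hg i h0]
    split_ifs with hx
    · rw [max_eq_left hx.le]
      exact le_of_eq (by ring)
    · rw [max_eq_right (not_lt.1 hx), mul_zero, zero_mul]
      exact mul_nonpos_of_nonneg_of_nonpos (mul_nonneg (hc i) (le_max_right _ _)) (not_lt.1 hx)
  refine (Finset.sum_le_sum fun i _ => hle i).trans (le_of_eq ?_)
  rcases (Finset.sum_nonneg fun i _ => hnn i).lt_or_eq with hP | hP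
  · have hhP : (∑ j, c j * max (x j) 0) * h = ∑ i, c i * max (x i) 0 * l i := by
      rw [hh hP, Finset.mul_sum]
      refine Finset.sum_congr rfl fun i _ => ?_
      field_simp
    simp only [mul_sub, Finset.sum_sub_distrib]
    rw [← Finset.sum_mul, hhP, sub_self]
  · have hzero := (Finset.sum_eq_zero_iff_of_nonneg fun i _ => hnn i).1 hP.symm
    exact Finset.sum_eq_zero fun i hi => by rw [hzero i hi, zero_mul]


/-- **Total wealth bound for Sleeping CB.** Let `(F_t)` be a sequence of even, strictly
positive potentials satisfying the wealth lower bound. Then the quantities produced by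
the Sleeping CB algorithm satisfy `∑_i π_i · F_{S_{T,i}}(∑_{t=1}^T ℐ_{t,i} g̃_{t,i}) ≤ 1`. -/
theorem sleeping_cb_total_wealth (N T : ℕ) (hN : 0 < N) (hT : 0 < T)
    (π : Fin N → ℝ) (hπ0 : ∀ i, 0 < π i) (hπ1 : ∑ i, π i = 1)
    (ℐ : ℕ → Fin N → ℕ) (hI01 : ∀ t i, ℐ t i ≤ 1)
    (hIpos : ∀ t ∈ Finset.Icc 1 T, 0 < ∑ i, π i * (ℐ t i : ℝ))
    (ℓ : ℕ → Fin N → ℝ) (hℓ : ∀ t i, ℓ t i ∈ Set.Icc (0 : ℝ) 1)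
    (F : ℕ → ℝ → ℝ) (hFpos : ∀ t x, 0 < F t x) (hFeven : ∀ t x, F t (-x) = F t x)
    -- the wealth lower bound satisfied by the coin betting potentials
    (hWealth : ∀ s : ℕ, 1 ≤ s → ∀ g w : ℕ → ℝ,
      (∀ τ ∈ Finset.Icc 1 s, |g τ| ≤ 1) →
      (∀ τ ∈ Finset.Icc 1 s, w τ =
        (F τ ((∑ σ ∈ Finset.Icc 1 (τ - 1), g σ) + 1) -
            F τ ((∑ σ ∈ Finset.Icc 1 (τ - 1), g σ) - 1)) /
          (F τ ((∑ σ ∈ Finset.Icc 1 (τ - 1), g σ) + 1) +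
            F τ ((∑ σ ∈ Finset.Icc 1 (τ - 1), g σ) - 1)) *
          (1 + ∑ σ ∈ Finset.Icc 1 (τ - 1), g σ * w σ)) →
      F s (∑ τ ∈ Finset.Icc 1 s, g τ) ≤ 1 + ∑ τ ∈ Finset.Icc 1 s, g τ * w τ)
    -- the quantities computed by the Sleeping CB algorithm
    (S : ℕ → Fin N → ℕ)
    (hS : ∀ t i, S t i = 1 + ∑ τ ∈ Finset.Icc 1 (t - 1), ℐ τ i)
    (w gt : ℕ → Fin N → ℝ) (p : ℕ → Fin N → ℝ) (h : ℕ → ℝ)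
    (hw : ∀ t ∈ Finset.Icc 1 T, ∀ i, w t i =
      (F (S t i) ((∑ τ ∈ Finset.Icc 1 (t - 1), (ℐ τ i : ℝ) * gt τ i) + 1) -
          F (S t i) ((∑ τ ∈ Finset.Icc 1 (t - 1), (ℐ τ i : ℝ) * gt τ i) - 1)) /
        (F (S t i) ((∑ τ ∈ Finset.Icc 1 (t - 1), (ℐ τ i : ℝ) * gt τ i) + 1) +
          F (S t i) ((∑ τ ∈ Finset.Icc 1 (t - 1), (ℐ τ i : ℝ) * gt τ i) - 1)) *
        (1 + ∑ τ ∈ Finset.Icc 1 (t - 1), (ℐ τ i : ℝ) * gt τ i * w τ i))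
    (hp : ∀ t ∈ Finset.Icc 1 T, ∀ i, p t i =
      if 0 < ∑ j, π j * (ℐ t j : ℝ) * max (w t j) 0 then
        π i * (ℐ t i : ℝ) * max (w t i) 0 / ∑ j, π j * (ℐ t j : ℝ) * max (w t j) 0
      else π i * (ℐ t i : ℝ) / ∑ j, π j * (ℐ t j : ℝ))
    (hh : ∀ t ∈ Finset.Icc 1 T, h t = ∑ i, p t i * ℓ t i)
    (hgt : ∀ t ∈ Finset.Icc 1 T, ∀ i, gt t i =
      if ℐ t i = 0 then 0
      else if 0 < w t i then h t - ℓ t i else max (h t - ℓ t i) 0) :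
    ∑ i, π i * F (S T i) (∑ t ∈ Finset.Icc 1 T, (ℐ t i : ℝ) * gt t i) ≤ 1 := by
  have hc : ∀ t i, 0 ≤ π i * (ℐ t i : ℝ) := fun t i => mul_nonneg (hπ0 i).le (Nat.cast_nonneg _)
  have hh01 : ∀ t ∈ Finset.Icc 1 T, h t ∈ Set.Icc (0 : ℝ) 1 := fun t ht => by
    rw [hh t ht]
    simp only [hp t ht]
    split_ifs
    · exact sum_div_sum_mul_mem_Icc _ _ (fun i => mul_nonneg (hc t i) (le_max_right _ _)) (hℓ t)
    · exact sum_div_sum_mul_mem_Icc _ _ (hc t) (hℓ t)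
  have hgt1 : ∀ t ∈ Finset.Icc 1 T, ∀ i, |(ℐ t i : ℝ) * gt t i| ≤ 1 := fun t ht i => by
    obtain ⟨h0, h1⟩ := hh01 t ht
    obtain ⟨l0, l1⟩ := hℓ t i
    rw [abs_mul, Nat.abs_cast]
    refine mul_le_one₀ (by exact_mod_cast hI01 t i) (abs_nonneg _) ?_
    rw [hgt t ht i]
    split_ifs
    · simp
    · exact abs_le.2 ⟨by linarith, by linarith⟩
    · exact abs_le.2 ⟨by linarith [le_max_right (h t - ℓ t i) 0],
        max_le (by linarith) zero_le_one⟩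
  have hround : ∀ t ∈ Finset.Icc 1 T, ∑ i, π i * (ℐ t i : ℝ) * gt t i * w t i ≤ 0 := fun t ht =>
    sum_mul_truncated_regret_mul_nonpos _ (w t) (ℓ t) _ (h t) (hc t)
      (fun hP => by
        rw [hh t ht]
        exact Finset.sum_congr rfl fun i _ => by rw [hp t ht i, if_pos hP])
      fun i hi => by
        have hI : ℐ t i ≠ 0 := fun h0 => hi (by simp [h0])
        rw [hgt t ht i, if_neg hI]
  let B : ℕ → ℝ → ℝ → ℝ := fun s z r =>
    (F s (z + 1) - F s (z - 1)) / (F s (z + 1) + F s (z - 1)) * (1 + r)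
  have hwealth : ∀ i, F (S T i) (∑ t ∈ Finset.Icc 1 T, (ℐ t i : ℝ) * gt t i) ≤
      1 + ∑ t ∈ Finset.Icc 1 T, (ℐ t i : ℝ) * gt t i * w t i := fun i => by
    obtain ⟨n, rfl⟩ : ∃ n, T = n + 1 := ⟨T - 1, by omega⟩
    have hsub : Finset.Icc 1 n ⊆ Finset.Icc 1 (n + 1) := Finset.Icc_subset_Icc_right n.le_succ
    have hmem : n + 1 ∈ Finset.Icc 1 (n + 1) := by simp
    have hwB : ∀ t ∈ Finset.Icc 1 (n + 1), w t i = B (1 + ∑ τ ∈ Finset.Icc 1 (t - 1), ℐ τ i)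
        (∑ τ ∈ Finset.Icc 1 (t - 1), (ℐ τ i : ℝ) * gt τ i)
        (∑ τ ∈ Finset.Icc 1 (t - 1), (ℐ τ i : ℝ) * gt τ i * w τ i) := fun t ht => by
      rw [hw t ht i, hS]
    -- An expert asleep in the last round contributes a final outcome `0`.
    have hreach := (BettingReachable.of_awake B (ℐ · i) (hI01 · i) (gt · i) (w · i) n
      (fun t ht => hgt1 t (hsub ht) i) fun t ht => hwB t (hsub ht)).succ (hgt1 _ hmem i)
    have hwn := hwB _ hmem
    rw [Nat.add_sub_cancel, add_comm 1] at hwn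
    rw [← hwn] at hreach
    obtain ⟨g, v, hg, hv, hz, hr⟩ := hreach
    rw [hS, Nat.add_sub_cancel, add_comm 1, Finset.sum_Icc_succ_top (by omega),
      Finset.sum_Icc_succ_top (by omega), ← hz, ← hr]
    exact hWealth _ (by omega) g v hg hv
  calc ∑ i, π i * F (S T i) (∑ t ∈ Finset.Icc 1 T, (ℐ t i : ℝ) * gt t i)
      ≤ ∑ i, π i * (1 + ∑ t ∈ Finset.Icc 1 T, (ℐ t i : ℝ) * gt t i * w t i) :=
        Finset.sum_le_sum fun i _ => mul_le_mul_of_nonneg_left (hwealth i) (hπ0 i).le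
    _ = 1 + ∑ t ∈ Finset.Icc 1 T, ∑ i, π i * (ℐ t i : ℝ) * gt t i * w t i := by
        simp only [mul_add, mul_one, Finset.sum_add_distrib, hπ1, Finset.mul_sum, mul_assoc]
        rw [Finset.sum_comm]
    _ ≤ 1 := by linarith [Finset.sum_nonpos hround]
end

section
/- The series ∑_{J∈𝒥} 1/( J₁²·(1 + ⌊log₂ J₁⌋) ), summed over all geometric covering intervals J with first element J₁, converges and its sum Z satisfies Z < π²/6. -/
theorem isGC.exists_dvd {A B : ℕ} (h : isGC A B) :
    ∃ k, k < Nat.log 2 A + 1 ∧ 2 ^ k ∣ A ∧ B = A + 2 ^ k - 1 := by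
  obtain ⟨k, i, hi, rfl, rfl⟩ := h
  refine ⟨k, ?_, Dvd.intro_left i rfl, by rw [add_mul, one_mul]⟩
  exact Nat.lt_succ_of_le
    (Nat.le_log_of_pow_le one_lt_two (Nat.le_mul_of_pos_left _ hi))

/-- The weight `1/(n²·(1+⌊log₂ n⌋))`, repeated `1+⌊log₂ n⌋` times for each `n`, sums to `π²/6`. -/
theorem hasSum_sigma_fin_log :
    HasSum (fun s : Σ n : ℕ, Fin (Nat.log 2 n + 1) =>
      1 / ((s.1 : ℝ) ^ 2 * (1 + (Nat.log 2 s.1 : ℝ)))) (Real.pi ^ 2 / 6) := by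
  have hfiber (n : ℕ) : ∑' _ : Fin (Nat.log 2 n + 1),
      1 / ((n : ℝ) ^ 2 * (1 + (Nat.log 2 n : ℝ))) = 1 / (n : ℝ) ^ 2 := by
    have h : (1 + (Nat.log 2 n : ℝ)) ≠ 0 := by positivity
    rw [tsum_fintype, Finset.sum_const, Finset.card_univ, Fintype.card_fin, nsmul_eq_mul]
    push_cast
    rw [add_comm (Nat.log 2 n : ℝ) 1, mul_one_div, mul_comm, div_mul_cancel_left₀ h, one_div]
  have hsum : Summable (fun s : Σ n : ℕ, Fin (Nat.log 2 n + 1) =>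
      1 / ((s.1 : ℝ) ^ 2 * (1 + (Nat.log 2 s.1 : ℝ)))) := by
    refine (summable_sigma_of_nonneg fun s => by positivity).2
      ⟨fun n => Summable.of_finite, ?_⟩
    simpa only [hfiber] using hasSum_zeta_two.summable
  refine hsum.hasSum_iff.2 ?_
  rw [hsum.tsum_sigma' fun n => Summable.of_finite]
  simpa only [hfiber] using hasSum_zeta_two.tsum_eq

/-- Composing a nonnegative series with an injection that misses a positive term
gives a convergent series with a strictly smaller sum. -/
theorem HasSum.summable_comp_and_tsum_comp_lt {α β : Type*} {g : β → ℝ} {a : ℝ}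
    (hg : HasSum g a) (hg0 : ∀ s, 0 ≤ g s) {f : α → β} (hf : Function.Injective f)
    {p : β} (hp : p ∉ Set.range f) (hpos : 0 < g p) :
    Summable (fun x => g (f x)) ∧ ∑' x, g (f x) < a := by
  refine ⟨hg.summable.comp_injective hf, ?_⟩
  calc ∑' x, g (f x) = ∑' s : Set.range f, g s := (tsum_range g hf).symm
    _ = ∑' s, (Set.range f).indicator g s := tsum_subtype _ _
    _ < ∑' s, g s := by
      refine Summable.tsum_lt_tsum (i := p) (Set.indicator_le_self' fun s _ => hg0 s) ?_
        (hg.summable.indicator _) hg.summable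
      rwa [Set.indicator_of_notMem hp]
    _ = a := hg.tsum_eq

/-- The series `∑_{J∈𝒥} 1/(J₁²·(1+⌊log₂ J₁⌋))` over all geometric covering intervals
converges, and its sum `Z` satisfies `Z < π²/6`. -/
theorem prior_normalization_bound :
    Summable (fun J : {q : ℕ × ℕ // isGC q.1 q.2} =>
      1 / ((J.1.1 : ℝ) ^ 2 * (1 + (Nat.log 2 J.1.1 : ℝ)))) ∧
    ∑' J : {q : ℕ × ℕ // isGC q.1 q.2},
      1 / ((J.1.1 : ℝ) ^ 2 * (1 + (Nat.log 2 J.1.1 : ℝ))) < Real.pi ^ 2 / 6 := by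
  choose k hk hdvd hB using fun J : {q : ℕ × ℕ // isGC q.1 q.2} => J.2.exists_dvd
  let f : {q : ℕ × ℕ // isGC q.1 q.2} → Σ n : ℕ, Fin (Nat.log 2 n + 1) :=
    fun J => ⟨J.1.1, k J, hk J⟩
  have hf : Function.Injective f := by
    intro J J' h
    have hA : J.1.1 = J'.1.1 := congrArg Sigma.fst h
    have hkk : k J = k J' :=
      congrArg (fun s : Σ n : ℕ, Fin (Nat.log 2 n + 1) => (s.2 : ℕ)) h
    refine Subtype.ext (Prod.ext hA ?_)
    rw [hB J, hB J', hA, hkk]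
  -- The pair `(3, 1)` is not of the form `f J`, as `2 ∤ 3`.
  obtain ⟨p, hp1, hp2⟩ : ∃ p : Σ n : ℕ, Fin (Nat.log 2 n + 1), p.1 = 3 ∧ (p.2 : ℕ) = 1 :=
    ⟨⟨3, 1, Nat.lt_succ_of_le (Nat.le_log_of_pow_le one_lt_two (by norm_num))⟩, rfl, rfl⟩
  have hp : p ∉ Set.range f := by
    rintro ⟨J, rfl⟩
    have h := hdvd J
    rw [show k J = 1 from hp2, show J.1.1 = 3 from hp1] at h
    omega
  have hpos : (0 : ℝ) < 1 / ((p.1 : ℝ) ^ 2 * (1 + (Nat.log 2 p.1 : ℝ))) := by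
    simp only [hp1]
    positivity
  have h := hasSum_sigma_fin_log.summable_comp_and_tsum_comp_lt
    (fun s => by positivity) hf hp hpos
  exact h
end
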